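/- arXiv:1805.08851 — 3 statements merged into one kernel-verified Lean document; each statement's English description precedes it below -/
import Mathlib

section
/- Let K be a number field with ring of integers O_K, and let a, b, c, e ∈ O_K generate four pairwise distinct prime ideals of O_K and satisfy: (1) a ≡ 1 mod 8·O_K and σ(a) > 0 for every real embedding σ : K → ℝ; (2) b ≡ 1 mod 2a·O_K; (3) c ≡ 1 mod 2·O_K and c is not congruent to a square of an element of O_K modulo the prime ideal (a); (4) e is not congruent to a square of an element of O_K modulo the prime ideal (a). Set d = c·e. Then for every nonzero prime ideal v of O_K there exist x, y, z in the v-adic completion K_v with y² − a·z² = b·(x⁴ + 2c·x² + d), and for every real embedding σ : K → ℝ there exist x, y, z ∈ ℝ with y² − σ(a)·z² = σ(b)·(x⁴ + 2σ(c)·x² + σ(d)). -/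
open NumberField IsDedekindDomain

open Complex in
theorem summable_cexp_neg_mul_int_sq {w : ℂ} (hw : 0 < w.re) :
    Summable fun n : ℤ ↦ cexp (-Real.pi * w * (n : ℂ) ^ 2) := by
  have h : Summable (jacobiTheta₂_term · 0 (I * w)) :=
    (summable_jacobiTheta₂_term_iff 0 (I * w)).mpr (by simpa using hw)
  refine h.congr fun n ↦ ?_
  rw [jacobiTheta₂_term]
  congr 1
  linear_combination (Real.pi * w * (n : ℂ) ^ 2) * I_sq

open Complex Filter Topology in
theorem tendsto_tsum_of_gaussian_bound {c : ℝ} (hc : 0 < c) (g : ℝ → ℤ → ℂ)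
    (hg0 : ∀ t, 0 < t → g t 0 = 1)
    (hg : ∀ t, 0 < t → ∀ n, ‖g t n‖ ≤ Real.exp (-Real.pi * (c * t) * (n : ℝ) ^ 2)) :
    Tendsto (fun t ↦ ∑' n, g t n) atTop (𝓝 1) := by
  have hsum : Summable fun n : ℤ ↦ Real.exp (-Real.pi * c * (n : ℝ) ^ 2) := by
    have h := (summable_cexp_neg_mul_int_sq (w := c) (by simpa using hc)).norm
    refine h.congr fun n ↦ ?_
    rw [Complex.norm_exp]
    congr 1
    have : (-Real.pi * c * (n : ℂ) ^ 2) = ((-Real.pi * c * (n : ℝ) ^ 2 : ℝ) : ℂ) := by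
      push_cast
      rfl
    rw [this, ofReal_re]
  have key : Tendsto (fun t ↦ ∑' n, g t n) atTop
      (𝓝 (∑' n : ℤ, if n = 0 then (1 : ℂ) else 0)) := by
    refine tendsto_tsum_of_dominated_convergence hsum (fun n ↦ ?_) ?_
    · by_cases hn : n = 0
      · subst hn
        refine tendsto_const_nhds.congr' ?_
        filter_upwards [eventually_gt_atTop 0] with t ht
        simp [hg0 t ht]
      · simp only [hn, if_false]
        rw [tendsto_zero_iff_norm_tendsto_zero]
        have hpos : 0 < Real.pi * c * (n : ℝ) ^ 2 := by positivity
        have hlim : Tendsto (fun t : ℝ ↦ Real.exp (-(Real.pi * c * (n : ℝ) ^ 2 * t))) atTop (𝓝 0) :=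
          Real.tendsto_exp_neg_atTop_nhds_zero.comp (tendsto_id.const_mul_atTop hpos)
        refine squeeze_zero' (Eventually.of_forall fun t ↦ norm_nonneg _) ?_ hlim
        filter_upwards [eventually_gt_atTop 0] with t ht
        refine (hg t ht n).trans (le_of_eq ?_)
        congr 1
        ring
    · filter_upwards [eventually_ge_atTop 1] with t ht n
      refine (hg t (by linarith) n).trans ?_
      rw [Real.exp_le_exp]
      have : c ≤ c * t := le_mul_of_one_le_right hc.le ht
      have := Real.pi_pos
      have h2 : Real.pi * c * (n : ℝ) ^ 2 ≤ Real.pi * (c * t) * (n : ℝ) ^ 2 := by gcongr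
      linarith
  simpa using key

theorem Complex.ofReal_mul_cpow {r : ℝ} (hr : 0 < r) {z : ℂ} (hz : z ≠ 0) (s : ℂ) :
    ((r : ℂ) * z) ^ s = (r : ℂ) ^ s * z ^ s := by
  have hr' : (r : ℂ) ≠ 0 := by exact_mod_cast hr.ne'
  rw [cpow_def_of_ne_zero (mul_ne_zero hr' hz), cpow_def_of_ne_zero hr', cpow_def_of_ne_zero hz,
    log_ofReal_mul hr hz, add_mul, exp_add, ofReal_log hr.le]

open Complex Filter Topology in
/-- A theta series at `i / t + 1 / (2 * N)`, split into residue classes modulo `m = 4 * N`. -/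
theorem tsum_gaussian_residues (m : ℕ) (hm : 0 < m) {t : ℝ} (ht : 0 < t) :
    ∑' n : ℤ, cexp (-Real.pi * (1 / t - 2 * I / m) * (n : ℂ) ^ 2) =
      ∑ r ∈ Finset.range m, cexp (2 * Real.pi * I * (r : ℂ) ^ 2 / m) *
        ((t / m ^ 2 : ℂ) ^ (1 / 2 : ℂ) *
          ∑' n : ℤ, cexp (-Real.pi * (t / m ^ 2) * (n : ℂ) ^ 2 + 2 * Real.pi * (-I * r / m) * n)) := by
  have : NeZero m := ⟨hm.ne'⟩
  have hmC : (m : ℂ) ≠ 0 := by exact_mod_cast hm.ne'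
  have htC : (t : ℂ) ≠ 0 := by exact_mod_cast ht.ne'
  have hre : 0 < (t / m ^ 2 : ℂ).re := by
    have : (t / m ^ 2 : ℂ) = ((t / m ^ 2 : ℝ) : ℂ) := by push_cast; rfl
    rw [this, ofReal_re]; positivity
  have hne : (t / m ^ 2 : ℂ) ^ (1 / 2 : ℂ) ≠ 0 := by
    rw [cpow_ne_zero_iff_of_exponent_ne_zero (by norm_num)]
    positivity
  have hsum : Summable fun n : ℤ ↦ cexp (-Real.pi * (1 / t - 2 * I / m) * (n : ℂ) ^ 2) := by
    apply summable_cexp_neg_mul_int_sq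
    have : (1 / t - 2 * I / m : ℂ) = ((1 / t : ℝ) : ℂ) + ((-(2 / m) : ℝ) : ℂ) * I := by
      push_cast
      ring
    rw [this]
    simpa using ht
  have hrw : ∀ r : ℕ, (t / m ^ 2 : ℂ) ^ (1 / 2 : ℂ) *
      ∑' n : ℤ, cexp (-Real.pi * (t / m ^ 2) * (n : ℂ) ^ 2 + 2 * Real.pi * (-I * r / m) * n) =
      ∑' n : ℤ, cexp (-Real.pi / (t / m ^ 2) * ((n : ℂ) + I * (-I * r / m)) ^ 2) := by
    intro r
    rw [Complex.tsum_exp_neg_quadratic hre, ← mul_assoc, mul_one_div_cancel hne, one_mul]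
  simp only [hrw]
  have hs2 := ((Int.divModEquiv m).trans (Equiv.prodComm ℤ (Fin m))).symm.summable_iff.mpr hsum
  refine ((Equiv.tsum_eq ((Int.divModEquiv m).trans (Equiv.prodComm ℤ (Fin m))).symm _).symm.trans
    (hs2.tsum_prod)).trans ?_
  rw [tsum_fintype, Finset.sum_range]
  refine Finset.sum_congr rfl fun r _ ↦ ?_
  rw [← tsum_mul_left]
  refine tsum_congr fun q ↦ ?_
  rw [Function.comp_apply, ← exp_add, Equiv.symm_trans_apply, Equiv.prodComm_symm,
    Equiv.prodComm_apply, Prod.swap_prod_mk,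
    Int.divModEquiv_symm_apply, exp_eq_exp_iff_exists_int]
  refine ⟨q ^ 2 * m + 2 * q * r, ?_⟩
  push_cast
  have h1 : I * (-I * r / m) = (r / m : ℂ) := by
    linear_combination (-r / m : ℂ) * I_sq
  rw [h1]
  field_simp
  ring

open Complex Filter Topology in
theorem tsum_gaussian_inversion (N : ℕ) (hN : 0 < N) {t : ℝ} (ht : 0 < t) :
    (1 / t - I / (2 * N) : ℂ) ^ (1 / 2 : ℂ) * (4 * N ^ 2 / (t + 2 * N * I) : ℂ) ^ (1 / 2 : ℂ) *
      ∑' n : ℤ, cexp (-Real.pi * (1 / t - I / (2 * N)) * (n : ℂ) ^ 2) =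
      ∑' n : ℤ, cexp (-Real.pi * ((t + 2 * N * I) / (4 * N ^ 2)) * (n : ℂ) ^ 2) := by
  have hNC : (N : ℂ) ≠ 0 := by exact_mod_cast hN.ne'
  have htC : (t : ℂ) ≠ 0 := by exact_mod_cast ht.ne'
  have hNR : (0 : ℝ) < N := by exact_mod_cast hN
  set A : ℂ := 1 / t - I / (2 * N) with hA
  set B : ℂ := 4 * N ^ 2 / (t + 2 * N * I) with hB
  have hAre : 0 < A.re := by
    have : A = ((1 / t : ℝ) : ℂ) + ((-(1 / (2 * N)) : ℝ) : ℂ) * I := by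
      rw [hA]; push_cast; ring
    rw [this]; simpa using ht
  have hden : (t + 2 * N * I : ℂ) ≠ 0 := fun h ↦ by
    have := congrArg re h
    simp at this
    exact ht.ne' this
  have hBinv : 1 / B = (t + 2 * N * I) / (4 * N ^ 2) := by
    rw [hB, one_div_div]
  have hBre : 0 < B.re := by
    have h1 : B⁻¹ = ((t / (4 * N ^ 2) : ℝ) : ℂ) + ((1 / (2 * N) : ℝ) : ℂ) * I := by
      rw [← one_div, hBinv]; push_cast; field_simp; ring
    have h2 : 0 < (B⁻¹).re := by
      rw [h1]
      have : 0 < t / (4 * N ^ 2 : ℝ) := by positivity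
      rw [add_re, ofReal_re, re_ofReal_mul, I_re]
      simpa using this
    rw [inv_re] at h2
    by_contra hle
    exact absurd h2 (not_lt.mpr (div_nonpos_of_nonpos_of_nonneg (not_lt.mp hle) (normSq_nonneg _)))
  have hA0 : A ≠ 0 := fun h ↦ by simp [h] at hAre
  have hB0 : B ≠ 0 := fun h ↦ by simp [h] at hBre
  have hAB : 1 / A = B + 2 * N * I := by
    have hB' : B * (t + 2 * N * I) = 4 * N ^ 2 := by rw [hB, div_mul_cancel₀ _ hden]
    have hA' : A = -I * (t + 2 * N * I) / (2 * N * t) := by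
      rw [hA]
      field_simp
      linear_combination (2 * N : ℂ) * I_sq
    rw [eq_comm, eq_div_iff hA0, hA', mul_div_assoc', div_eq_one_iff_eq
      (mul_ne_zero (mul_ne_zero two_ne_zero hNC) htC)]
    linear_combination (-I) * hB' - (2 * N * (t + 2 * N * I)) * I_sq
  have hcp : ∀ z : ℂ, z ≠ 0 → z ^ (1 / 2 : ℂ) ≠ 0 := fun z hz ↦ by
    rw [cpow_ne_zero_iff_of_exponent_ne_zero (by norm_num)]
    exact hz
  rw [Complex.tsum_exp_neg_mul_int_sq hAre]
  have hshift : ∑' n : ℤ, cexp (-Real.pi / A * (n : ℂ) ^ 2) =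
      ∑' n : ℤ, cexp (-Real.pi * B * (n : ℂ) ^ 2) := by
    refine tsum_congr fun n ↦ ?_
    rw [div_eq_mul_one_div, hAB, exp_eq_exp_iff_exists_int]
    refine ⟨-(N * n ^ 2), ?_⟩
    push_cast
    ring
  rw [hshift, Complex.tsum_exp_neg_mul_int_sq hBre, ← hBinv]
  have := hcp A hA0
  have := hcp B hB0
  field_simp

open Complex Filter Topology in
/-- The quadratic Gauss sum modulo `4 * N` is a positive multiple of `1 + i`. -/
theorem exists_pos_quadratic_gauss_sum_four_mul (N : ℕ) (hN : 0 < N) :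
    ∃ r : ℝ, 0 < r ∧
      ∑ x ∈ Finset.range (4 * N), cexp (2 * Real.pi * I * (x : ℂ) ^ 2 / (4 * N : ℕ)) =
        r * (1 + I) := by
  have hNC : (N : ℂ) ≠ 0 := by exact_mod_cast hN.ne'
  have hNR : (0 : ℝ) < N := by exact_mod_cast hN
  set m := 4 * N with hm
  have hmR : (0 : ℝ) < m := by rw [hm]; positivity
  set G := ∑ x ∈ Finset.range m, cexp (2 * Real.pi * I * (x : ℂ) ^ 2 / (m : ℕ)) with hG
  have hmC : (m : ℂ) = 4 * N := by rw [hm]; push_cast; ring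
  let S : ℝ → ℂ := fun t ↦ ∑ r ∈ Finset.range m, cexp (2 * Real.pi * I * (r : ℂ) ^ 2 / m) *
    ∑' n : ℤ, cexp (-Real.pi * (t / m ^ 2) * (n : ℂ) ^ 2 + 2 * Real.pi * (-I * r / m) * n)
  have hS : Tendsto S atTop (𝓝 G) := by
    have : G = ∑ x ∈ Finset.range m, cexp (2 * Real.pi * I * (x : ℂ) ^ 2 / (m : ℕ)) * 1 := by
      simp [hG]
    rw [this]
    refine tendsto_finsetSum _ fun r _ ↦ Tendsto.const_mul _ ?_
    refine tendsto_tsum_of_gaussian_bound (c := 1 / (m : ℝ) ^ 2) (by positivity)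
      (fun t (n : ℤ) ↦ cexp (-Real.pi * (t / m ^ 2) * (n : ℂ) ^ 2 + 2 * Real.pi * (-I * r / m) * n))
      (fun t _ ↦ by simp) fun t ht n ↦ ?_
    rw [norm_exp]
    refine le_of_eq (congrArg _ ?_)
    have : (-Real.pi * (t / m ^ 2) * (n : ℂ) ^ 2 + 2 * Real.pi * (-I * r / m) * n) =
        ((-Real.pi * (1 / (m : ℝ) ^ 2 * t) * (n : ℝ) ^ 2 : ℝ) : ℂ) +
          ((-2 * Real.pi * r / m * n : ℝ) : ℂ) * I := by
      push_cast; ring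
    rw [this, add_re, ofReal_re, re_ofReal_mul, I_re]
    ring
  let P : ℝ → ℂ := fun t ↦
    ∑' n : ℤ, cexp (-Real.pi * ((t + 2 * N * I) / (4 * N ^ 2)) * (n : ℂ) ^ 2)
  have hP : Tendsto P atTop (𝓝 1) := by
    refine tendsto_tsum_of_gaussian_bound (c := 1 / (4 * (N : ℝ) ^ 2)) (by positivity)
      (fun t (n : ℤ) ↦ cexp (-Real.pi * ((t + 2 * N * I) / (4 * N ^ 2)) * (n : ℂ) ^ 2))
      (fun t _ ↦ by simp) fun t ht n ↦ ?_
    rw [norm_exp]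
    refine le_of_eq (congrArg _ ?_)
    have : (-Real.pi * ((t + 2 * N * I) / (4 * N ^ 2)) * (n : ℂ) ^ 2) =
        ((-Real.pi * (1 / (4 * (N : ℝ) ^ 2) * t) * (n : ℝ) ^ 2 : ℝ) : ℂ) +
          ((-Real.pi * (2 * N) / (4 * (N : ℝ) ^ 2) * (n : ℝ) ^ 2 : ℝ) : ℂ) * I := by
      push_cast; ring
    rw [this, add_re, ofReal_re, re_ofReal_mul, I_re]
    ring
  let A : ℝ → ℂ := fun t ↦ (1 / t - I / (2 * N) : ℂ)
  let D : ℝ → ℂ := fun t ↦ (4 * N ^ 2 / (1 + 2 * N * I * (1 / t)) : ℂ)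
  have hinv : Tendsto (fun t : ℝ ↦ (1 / t : ℂ)) atTop (𝓝 0) := by
    have := (continuous_ofReal.tendsto 0).comp tendsto_inv_atTop_zero
    simpa [Function.comp_def, one_div] using this
  have hA : Tendsto A atTop (𝓝 (((1 / (2 * N) : ℝ) : ℂ) * (-I))) := by
    have := hinv.sub_const (I / (2 * N))
    refine this.trans (le_of_eq ?_)
    congr 1
    push_cast; ring
  have hD : Tendsto D atTop (𝓝 (4 * N ^ 2)) := by
    have h1 : Tendsto (fun t : ℝ ↦ (1 + 2 * N * I * (1 / t) : ℂ)) atTop (𝓝 (1 + 2 * N * I * 0)) :=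
      (hinv.const_mul _).const_add _
    have := (tendsto_const_nhds (x := (4 * N ^ 2 : ℂ))).div h1 (by simp)
    simpa [D, Pi.div_def] using this
  have hid : ∀ᶠ t in atTop, ((1 / (m : ℝ) ^ 2 : ℝ) : ℂ) ^ (1 / 2 : ℂ) * S t * A t ^ (1 / 2 : ℂ) *
      D t ^ (1 / 2 : ℂ) = P t := by
    filter_upwards [eventually_gt_atTop 0] with t ht
    have htC : (t : ℂ) ≠ 0 := by exact_mod_cast ht.ne'
    have hden : (t + 2 * N * I : ℂ) ≠ 0 := fun h ↦ by
      have := congrArg re h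
      simp at this
      exact ht.ne' this
    have hden' : (1 + 2 * N * I * (1 / t) : ℂ) ≠ 0 := fun h ↦ hden (by
      field_simp at h
      linear_combination h)
    have hD0 : D t ≠ 0 :=
      div_ne_zero (mul_ne_zero (by norm_num) (pow_ne_zero 2 hNC)) hden'
    have hBD : (4 * N ^ 2 / (t + 2 * N * I) : ℂ) = ((1 / t : ℝ) : ℂ) * D t := by
      simp only [D]
      have h6 : (t + 2 * N * I : ℂ) = t * (1 + 2 * N * I * (1 / t)) := by field_simp
      rw [h6]
      push_cast
      rw [div_mul_div_comm, one_mul]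
    have h1 := tsum_gaussian_inversion N hN ht
    have h2 := tsum_gaussian_residues m (by positivity) ht
    have h3 : (2 * I / m : ℂ) = I / (2 * N) := by rw [hmC]; field_simp; norm_num
    have h4 : (t / m ^ 2 : ℂ) = (t : ℂ) * ((1 / (m : ℝ) ^ 2 : ℝ) : ℂ) := by push_cast; ring
    rw [h3] at h2
    rw [h2, hBD, ofReal_mul_cpow (by positivity) hD0, h4,
      ofReal_mul_cpow ht (by exact_mod_cast (by positivity))] at h1
    have h5 : (t : ℂ) ^ (1 / 2 : ℂ) * ((1 / t : ℝ) : ℂ) ^ (1 / 2 : ℂ) = 1 := by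
      rw [← ofReal_mul_cpow ht (by exact_mod_cast (by positivity))]
      push_cast
      rw [mul_one_div_cancel htC, one_cpow]
    rw [← h4] at h1
    simp only [P]
    rw [← h1]
    simp only [S, Finset.mul_sum, Finset.sum_mul, A]
    refine Finset.sum_congr rfl fun r _ ↦ ?_
    linear_combination (-((1 / (m : ℝ) ^ 2 : ℝ) : ℂ) ^ (1 / 2 : ℂ) *
      cexp (2 * Real.pi * I * (r : ℂ) ^ 2 / m) * (∑' n : ℤ, cexp (-Real.pi * (t / m ^ 2) * (n : ℂ) ^ 2 + 2 * Real.pi * (-I * r / m) * n)) * (1 / t - I / (2 * N) : ℂ) ^ (1 / 2 : ℂ) *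
      D t ^ (1 / 2 : ℂ)) * h5
  have hlim := ((hS.const_mul (((1 / (m : ℝ) ^ 2 : ℝ) : ℂ) ^ (1 / 2 : ℂ))).mul
    ((continuousAt_cpow_const (b := (1 / 2 : ℂ)) ?_).tendsto.comp hA)).mul
      ((continuousAt_cpow_const (b := (1 / 2 : ℂ)) ?_).tendsto.comp hD)
  · have heq := tendsto_nhds_unique (hlim.congr' hid) hP
    rw [ofReal_mul_cpow (by positivity) (by simp)] at heq
    have h4N : (4 * N ^ 2 : ℂ) = ((4 * N ^ 2 : ℝ) : ℂ) := by push_cast; rfl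
    have hhalf : (1 / 2 : ℂ) = ((1 / 2 : ℝ) : ℂ) := by push_cast; rfl
    have hI : (-I) ^ (1 / 2 : ℂ) = ((√2 / 2 : ℝ) : ℂ) * (1 - I) := by
      rw [cpow_def_of_ne_zero (by simp), log_neg_I,
        show (-(Real.pi / 2) * I * (1 / 2) : ℂ) = ((-(Real.pi / 4) : ℝ) : ℂ) * I by push_cast; ring,
        exp_mul_I, ← ofReal_cos, ← ofReal_sin, Real.cos_neg, Real.sin_neg, Real.cos_pi_div_four,
        Real.sin_pi_div_four]
      push_cast
      ring
    rw [hI, h4N, hhalf, ← ofReal_cpow (by positivity), ← ofReal_cpow (by positivity),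
      ← ofReal_cpow (by positivity)] at heq
    set p := (1 / (m : ℝ) ^ 2) ^ (1 / 2 : ℝ)
    set q := (1 / (2 * N) : ℝ) ^ (1 / 2 : ℝ)
    set w := (4 * N ^ 2 : ℝ) ^ (1 / 2 : ℝ)
    have hpq : 0 < p * q * w * (√2 / 2) := by positivity
    refine ⟨1 / (2 * (p * q * w * (√2 / 2))), by positivity, ?_⟩
    have hne : ((p * q * w * (√2 / 2) : ℝ) : ℂ) ≠ 0 := by exact_mod_cast hpq.ne'
    have h6 : ((p * q * w * (√2 / 2) : ℝ) : ℂ) * (G * (1 - I)) = 1 := by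
      refine Eq.trans ?_ heq
      push_cast
      ring
    have h7 : G * (1 - I) = 1 / ((p * q * w * (√2 / 2) : ℝ) : ℂ) := by
      rw [eq_div_iff hne, mul_comm, h6]
    have h8 : G = G * (1 - I) * (1 + I) / 2 := by linear_combination (G / 2) * I_sq
    rw [h8, h7]
    push_cast
    ring
  · right
    have : (0 : ℝ) < 1 / (2 * N) := by positivity
    rw [im_ofReal_mul, neg_im, I_im]
    linarith
  · left
    have : (4 * N ^ 2 : ℂ) = ((4 * N ^ 2 : ℝ) : ℂ) := by push_cast; rfl
    rw [this, ofReal_re]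
    positivity

open Complex in
/-- The character `x ↦ exp (2 π i x)` of `ℚ`. -/
noncomputable def ratExp (x : ℚ) : ℂ := cexp (2 * Real.pi * I * x)

theorem ratExp_add (x y : ℚ) : ratExp (x + y) = ratExp x * ratExp y := by
  rw [ratExp, ratExp, ratExp, ← Complex.exp_add]
  push_cast
  ring_nf

theorem ratExp_intCast (n : ℤ) : ratExp n = 1 := by
  rw [ratExp, Complex.exp_eq_one_iff]
  exact ⟨n, by push_cast; ring⟩

theorem ratExp_zero : ratExp 0 = 1 := by
  simpa using ratExp_intCast 0

theorem ratExp_eq_one_iff {x : ℚ} : ratExp x = 1 ↔ ∃ n : ℤ, x = n := by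
  refine ⟨fun h ↦ ?_, fun ⟨n, hn⟩ ↦ hn ▸ ratExp_intCast n⟩
  rw [ratExp, Complex.exp_eq_one_iff] at h
  obtain ⟨n, hn⟩ := h
  refine ⟨n, ?_⟩
  have h2 : (2 * Real.pi * Complex.I : ℂ) * x = (2 * Real.pi * Complex.I) * n := by
    rw [hn]; ring
  exact_mod_cast mul_left_cancel₀ Complex.two_pi_I_ne_zero h2

theorem ratExp_sum {ι : Type*} (s : Finset ι) (x : ι → ℚ) :
    ratExp (∑ i ∈ s, x i) = ∏ i ∈ s, ratExp (x i) := by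
  classical
  induction s using Finset.induction_on with
  | empty => simp [ratExp_zero]
  | insert i s hi ih => rw [Finset.sum_insert hi, Finset.prod_insert hi, ratExp_add, ih]

/-- `p` is a system of representatives of the cosets of `Λ'` in `Λ`. -/
def IsCosetReps {V ι : Type*} [AddCommGroup V] (Λ Λ' : AddSubgroup V) (p : ι → V) : Prop :=
  (∀ i, p i ∈ Λ) ∧ ∀ x ∈ Λ, ∃! i, x - p i ∈ Λ'

namespace IsCosetReps

variable {V : Type*} [AddCommGroup V] {Λ Λ' Λ'' : AddSubgroup V}

theorem eq_of_sub_mem {ι : Type*} {p : ι → V} (hp : IsCosetReps Λ Λ' p) {i j : ι}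
    (h : p i - p j ∈ Λ') : i = j :=
  (hp.2 (p i) (hp.1 i)).unique (by simp [Λ'.zero_mem]) h

theorem sum_eq {ι κ : Type*} [Fintype ι] [Fintype κ] {p : ι → V} {p' : κ → V}
    (hp : IsCosetReps Λ Λ' p) (hp' : IsCosetReps Λ Λ' p') {f : V → ℂ}
    (hf : ∀ x ∈ Λ, ∀ y ∈ Λ, x - y ∈ Λ' → f x = f y) : ∑ i, f (p i) = ∑ j, f (p' j) := by
  choose σ hσ _ using fun i ↦ hp'.2 (p i) (hp.1 i)
  refine Fintype.sum_bijective σ ⟨fun i j hij ↦ ?_, fun j ↦ ?_⟩ _ _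
    fun i ↦ hf _ (hp.1 i) _ (hp'.1 _) (hσ i)
  · refine hp.eq_of_sub_mem ?_
    have h := Λ'.sub_mem (hσ i) (hσ j)
    simp only [hij] at h
    simpa using h
  · obtain ⟨i, hi, -⟩ := hp.2 (p' j) (hp'.1 j)
    refine ⟨i, (hp'.eq_of_sub_mem ?_)⟩
    have h := Λ'.neg_mem (Λ'.add_mem hi (hσ i))
    simpa using h

theorem prod {ι κ : Type*} {p : ι → V} {q : κ → V} (h : Λ' ≤ Λ) (h' : Λ'' ≤ Λ')
    (hp : IsCosetReps Λ Λ' p) (hq : IsCosetReps Λ' Λ'' q) :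
    IsCosetReps Λ Λ'' fun x : ι × κ ↦ p x.1 + q x.2 := by
  refine ⟨fun x ↦ Λ.add_mem (hp.1 _) (h (hq.1 _)), fun x hx ↦ ?_⟩
  obtain ⟨i, hi, hi'⟩ := hp.2 x hx
  obtain ⟨j, hj, hj'⟩ := hq.2 _ hi
  refine ⟨(i, j), by simpa [sub_sub] using hj, fun ⟨i', j'⟩ hij ↦ ?_⟩
  have h1 : x - p i' ∈ Λ' := by
    have := Λ'.add_mem (h' hij) (hq.1 j')
    simpa [sub_add_eq_sub_sub] using this
  have hii : i' = i := hi' _ h1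
  subst hii
  rw [hj' j' (by simpa [sub_sub] using hij)]

theorem exists_out (Λ Λ' : AddSubgroup V) :
    IsCosetReps Λ Λ' fun x : Λ ⧸ Λ'.addSubgroupOf Λ ↦ (x.out : V) := by
  refine ⟨fun x ↦ x.out.2, fun x hx ↦ ⟨QuotientAddGroup.mk ⟨x, hx⟩, ?_, fun j hj ↦ ?_⟩⟩
  · have := QuotientAddGroup.eq.mp (QuotientAddGroup.out_eq'
      (QuotientAddGroup.mk ⟨x, hx⟩ : Λ ⧸ Λ'.addSubgroupOf Λ))
    rw [AddSubgroup.mem_addSubgroupOf] at this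
    simpa [sub_eq_neg_add] using this
  · rw [← QuotientAddGroup.out_eq' j, QuotientAddGroup.eq, AddSubgroup.mem_addSubgroupOf]
    simpa [sub_eq_neg_add] using hj

theorem finite_quotient_top {ι : Type*} [Finite ι] {p : ι → V} (h : Λ'' ≤ Λ')
    (hp : IsCosetReps Λ Λ'' p) : Finite (Λ ⧸ Λ'.addSubgroupOf Λ) := by
  refine Finite.of_surjective (fun i ↦ (QuotientAddGroup.mk ⟨p i, hp.1 i⟩)) fun x ↦ ?_
  obtain ⟨x, rfl⟩ := QuotientAddGroup.mk_surjective x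
  obtain ⟨i, hi, -⟩ := hp.2 x x.2
  refine ⟨i, ?_⟩
  rw [QuotientAddGroup.eq, AddSubgroup.mem_addSubgroupOf]
  simpa [sub_eq_neg_add] using h hi

theorem finite_quotient_bot {ι : Type*} [Finite ι] {p : ι → V} (h : Λ' ≤ Λ)
    (hp : IsCosetReps Λ Λ'' p) : Finite (Λ' ⧸ Λ''.addSubgroupOf Λ') := by
  choose σ hσ _ using fun x : Λ' ⧸ Λ''.addSubgroupOf Λ' ↦ hp.2 x.out (h x.out.2)
  refine Finite.of_injective σ fun x y hxy ↦ ?_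
  rw [← QuotientAddGroup.out_eq' x, ← QuotientAddGroup.out_eq' y, QuotientAddGroup.eq,
    AddSubgroup.mem_addSubgroupOf]
  have h := Λ''.sub_mem (hσ y) (hσ x)
  simp only [hxy, sub_sub_sub_cancel_right] at h
  simpa [sub_eq_neg_add] using h

theorem sum_char_eq_zero {ι : Type*} [Fintype ι] {p : ι → V} (hp : IsCosetReps Λ Λ' p)
    (χ : V →+ ℚ) (h' : ∀ x ∈ Λ', ratExp (χ x) = 1) {d : V} (hd : d ∈ Λ) (h : ratExp (χ d) ≠ 1) :
    ∑ i, ratExp (χ (p i)) = 0 := by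
  have hq : IsCosetReps Λ Λ' fun i ↦ p i + d := by
    refine ⟨fun i ↦ Λ.add_mem (hp.1 i) hd, fun x hx ↦ ?_⟩
    obtain ⟨i, hi, hi'⟩ := hp.2 (x - d) (Λ.sub_mem hx hd)
    refine ⟨i, ?_, fun j hj ↦ hi' j ?_⟩
    · simpa [sub_sub, add_comm] using hi
    · simpa [sub_sub, add_comm] using hj
  have hs := hp.sum_eq hq (f := fun x ↦ ratExp (χ x)) fun x _ y _ hxy ↦ by
    rw [show x = (x - y) + y by abel, map_add, ratExp_add, h' _ hxy, one_mul]
  simp only [map_add, ratExp_add, ← Finset.sum_mul] at hs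
  have : (∑ i, ratExp (χ (p i))) * (1 - ratExp (χ d)) = 0 := by linear_combination hs
  exact (mul_eq_zero.mp this).resolve_right (sub_ne_zero.mpr h.symm)

end IsCosetReps

/-- The elements pairing integrally with `Λ` under `B`. -/
def dualLattice {V : Type*} [AddCommGroup V] (B : V →+ V →+ ℚ) (Λ : AddSubgroup V) :
    AddSubgroup V where
  carrier := {x | ∀ y ∈ Λ, ∃ n : ℤ, B x y = n}
  zero_mem' y _ := ⟨0, by simp⟩
  add_mem' := fun hx hx' y hy ↦ by
    obtain ⟨n, hn⟩ := hx y hy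
    obtain ⟨n', hn'⟩ := hx' y hy
    exact ⟨n + n', by simp [hn, hn']⟩
  neg_mem' := fun hx y hy ↦ by
    obtain ⟨n, hn⟩ := hx y hy
    exact ⟨-n, by simp [hn]⟩

theorem mem_dualLattice {V : Type*} [AddCommGroup V] {B : V →+ V →+ ℚ} {Λ : AddSubgroup V}
    {x : V} : x ∈ dualLattice B Λ ↔ ∀ y ∈ Λ, ∃ n : ℤ, B x y = n := Iff.rfl

/-- A Gauss sum over a large lattice quotient is a positive multiple of the Gauss sum of the
discriminant form of an even lattice `Λ`. -/
theorem exists_gauss_sum_eq_mul_discriminant {V : Type*} [AddCommGroup V] (q : V → ℚ)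
    (B : V →+ V →+ ℚ) (hq : ∀ x y, q (x + y) = q x + q y + B x y) {Λ Λ₁ Λ₂ : AddSubgroup V}
    (h0 : ∀ x ∈ Λ, ∃ n : ℤ, q x = n) (h1 : dualLattice B Λ ≤ Λ₁) (h2 : Λ₂ ≤ Λ)
    (h12 : ∀ x ∈ Λ₁, ∀ y ∈ Λ₂, ∃ n : ℤ, B x y = n)
    {κ ι : Type*} [Fintype κ] [Fintype ι] {p : κ → V} (hp : IsCosetReps Λ₁ Λ₂ p) {s : ι → V}
    (hs : IsCosetReps (dualLattice B Λ) Λ s) :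
    ∃ k : ℕ, 0 < k ∧ ∑ i, ratExp (q (p i)) = k * ∑ i, ratExp (q (s i)) := by
  classical
  have hΛd : Λ ≤ dualLattice B Λ := fun x hx y hy ↦ by
    obtain ⟨n, hn⟩ := h0 _ (Λ.add_mem hx hy)
    obtain ⟨m, hm⟩ := h0 _ hx
    obtain ⟨l, hl⟩ := h0 _ hy
    exact ⟨n - m - l, by push_cast; linear_combination hn - hq x y - hm - hl⟩
  have hΛ1 := hΛd.trans h1
  have := hp.finite_quotient_top h2
  have := hp.finite_quotient_bot hΛ1
  have := Fintype.ofFinite (Λ₁ ⧸ Λ.addSubgroupOf Λ₁)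
  have := Fintype.ofFinite (Λ ⧸ Λ₂.addSubgroupOf Λ)
  have ha := IsCosetReps.exists_out Λ₁ Λ
  have hd := IsCosetReps.exists_out Λ Λ₂
  set a : Λ₁ ⧸ Λ.addSubgroupOf Λ₁ → V := fun x ↦ (x.out : V)
  set d : Λ ⧸ Λ₂.addSubgroupOf Λ → V := fun x ↦ (x.out : V)
  have hqz : ∀ x y, (∃ n : ℤ, q y = n) → (∃ n : ℤ, B x y = n) →
      ratExp (q (x + y)) = ratExp (q x) := fun x y ⟨n, hn⟩ ⟨m, hm⟩ ↦ by
    rw [hq, hn, hm, ratExp_add, ratExp_add, ratExp_intCast, ratExp_intCast, mul_one, mul_one]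
  refine ⟨Fintype.card (Λ ⧸ Λ₂.addSubgroupOf Λ), Fintype.card_pos, ?_⟩
  rw [hp.sum_eq (ha.prod hΛ1 h2 hd) (f := fun x ↦ ratExp (q x)) fun x hx y hy hxy ↦ ?_]
  · rw [Fintype.sum_prod_type]
    have hinner : ∀ i, ∑ j, ratExp (q (a i + d j)) =
        if a i ∈ dualLattice B Λ then
          (Fintype.card (Λ ⧸ Λ₂.addSubgroupOf Λ) : ℂ) * ratExp (q (a i)) else 0 := fun i ↦ by
      have h3 : ∀ j, ratExp (q (a i + d j)) = ratExp (q (a i)) * ratExp (B (a i) (d j)) :=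
        fun j ↦ by
          obtain ⟨n, hn⟩ := h0 _ (hd.1 j)
          rw [hq, hn, ratExp_add, ratExp_add, ratExp_intCast, mul_one]
      simp only [h3, ← Finset.mul_sum]
      split_ifs with hi
      · have h4 : ∀ j, ratExp (B (a i) (d j)) = 1 := fun j ↦
          ratExp_eq_one_iff.mpr (hi _ (hd.1 j))
        simp [h4, mul_comm]
      · rw [mem_dualLattice] at hi
        push Not at hi
        obtain ⟨y, hy, hy'⟩ := hi
        rw [hd.sum_char_eq_zero (B (a i)) (fun x hx ↦
          ratExp_eq_one_iff.mpr (h12 _ (ha.1 i) _ hx)) hy, mul_zero]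
        rw [Ne, ratExp_eq_one_iff]
        rintro ⟨n, hn⟩
        exact hy' n hn
    simp only [hinner]
    rw [← Finset.sum_filter, ← Finset.mul_sum]
    congr 1
    have hsub : IsCosetReps (dualLattice B Λ) Λ fun i : {i // a i ∈ dualLattice B Λ} ↦ a i := by
      refine ⟨fun i ↦ i.2, fun x hx ↦ ?_⟩
      obtain ⟨i, hi, hi'⟩ := ha.2 x (h1 hx)
      refine ⟨⟨i, ?_⟩, hi, fun j hj ↦ Subtype.ext (hi' _ hj)⟩
      have := (dualLattice B Λ).sub_mem hx (hΛd hi)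
      simpa using this
    rw [← hsub.sum_eq hs (f := fun x ↦ ratExp (q x)) fun x hx y hy hxy ↦ ?_]
    · rw [Finset.sum_subtype (p := fun i ↦ a i ∈ dualLattice B Λ) _ (by simp)]
    · rw [show x = y + (x - y) by abel]
      exact hqz _ _ (h0 _ hxy) (hy _ hxy)
  · rw [show x = y + (x - y) by abel]
    exact hqz _ _ (h0 _ (h2 hxy)) (h12 _ hy _ hxy)

theorem ratExp_neg (x : ℚ) : ratExp (-x) = starRingEnd ℂ (ratExp x) := by
  rw [ratExp, ratExp, ← Complex.exp_conj]
  congr 1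
  simp [Complex.conj_ofNat]

theorem sum_range_mul_of_periodic {f : ℕ → ℂ} {m : ℕ} (hf : ∀ x, f (m + x) = f x) (k : ℕ) :
    ∑ x ∈ Finset.range (m * k), f x = k * ∑ x ∈ Finset.range m, f x := by
  induction k with
  | zero => simp
  | succ k ih =>
    rw [Nat.mul_succ, add_comm, Finset.sum_range_add]
    simp only [hf, ih]
    push_cast
    ring

theorem exists_pos_sum_ratExp_sq {n k : ℕ} (hn : 0 < n) (hk : 0 < k) :
    ∃ r : ℝ, 0 < r ∧ ∑ x ∈ Finset.range (4 * n * k), ratExp ((x : ℚ) ^ 2 / (4 * n)) =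
      r * (1 + Complex.I) := by
  obtain ⟨r, hr, h⟩ := exists_pos_quadratic_gauss_sum_four_mul n hn
  refine ⟨k * r, by positivity, ?_⟩
  have hnQ : (n : ℚ) ≠ 0 := by exact_mod_cast hn.ne'
  rw [sum_range_mul_of_periodic fun x ↦ ?_]
  · have : ∀ x : ℕ, ratExp ((x : ℚ) ^ 2 / (4 * n)) =
        Complex.exp (2 * Real.pi * Complex.I * (x : ℂ) ^ 2 / (4 * n : ℕ)) := fun x ↦ by
      rw [ratExp]
      push_cast
      rw [mul_div_assoc]
    simp only [this, h]
    push_cast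
    ring
  · have : ((4 * n + x : ℕ) : ℚ) ^ 2 / (4 * n) = (x : ℚ) ^ 2 / (4 * n) + (4 * n + 2 * x : ℤ) := by
      push_cast
      field_simp
      ring
    rw [this, ratExp_add, ratExp_intCast, mul_one]

theorem exists_pos_sum_ratExp_mul_sq_of_mul_eq_one {c : ℚ} {N n k : ℕ}
    (hn : c * (4 * n) = 1) (hN : N = 4 * n * k) (hN0 : 0 < N) :
    ∃ r : ℝ, 0 < r ∧ ∑ x ∈ Finset.range N, ratExp (c * (x : ℚ) ^ 2) = r * (1 + Complex.I) := by
  have hn0 : 0 < n := Nat.pos_of_ne_zero fun h ↦ by simp [h] at hn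
  have hk0 : 0 < k := Nat.pos_of_ne_zero fun h ↦ by simp [h] at hN; omega
  obtain ⟨r, hr, h⟩ := exists_pos_sum_ratExp_sq hn0 hk0
  refine ⟨r, hr, ?_⟩
  rw [hN, ← h]
  refine Finset.sum_congr rfl fun x _ ↦ ?_
  have hnQ : (n : ℚ) ≠ 0 := by exact_mod_cast hn0.ne'
  rw [show c = 1 / (4 * n) by rw [eq_div_iff (by positivity), hn]]
  congr 1
  ring

theorem exists_pos_sum_ratExp_mul_sq {c : ℚ} (hc : c ≠ 0) {N n k : ℕ}
    (hn : |c| * (4 * n) = 1) (hN : N = 4 * n * k) (hN0 : 0 < N) :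
    ∃ r : ℝ, 0 < r ∧ ∑ x ∈ Finset.range N, ratExp (c * (x : ℚ) ^ 2) =
      r * if 0 < c then 1 + Complex.I else 1 - Complex.I := by
  rcases lt_or_gt_of_ne hc with h | h
  · rw [abs_of_neg h] at hn
    obtain ⟨r, hr, hs⟩ := exists_pos_sum_ratExp_mul_sq_of_mul_eq_one hn hN hN0
    refine ⟨r, hr, ?_⟩
    rw [if_neg h.not_gt]
    have := congrArg (starRingEnd ℂ) hs
    rw [map_sum] at this
    simp only [← ratExp_neg] at this
    simpa [← sub_eq_add_neg] using this
  · rw [abs_of_pos h] at hn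
    obtain ⟨r, hr, hs⟩ := exists_pos_sum_ratExp_mul_sq_of_mul_eq_one hn hN hN0
    exact ⟨r, hr, by rw [if_pos h, hs]⟩

/-- The lattice spanned by `1 / M` times a rational basis. -/
def scaledLattice {V ι : Type*} [AddCommGroup V] [Module ℚ V] (v : Module.Basis ι ℚ V) (m : ℚ) :
    AddSubgroup V where
  carrier := {x | ∀ i, ∃ n : ℤ, v.repr x i = n * m}
  zero_mem' i := ⟨0, by simp⟩
  add_mem' := fun hx hy i ↦ by
    obtain ⟨n, hn⟩ := hx i
    obtain ⟨n', hn'⟩ := hy i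
    exact ⟨n + n', by simp [hn, hn', add_mul]⟩
  neg_mem' := fun hx i ↦ by
    obtain ⟨n, hn⟩ := hx i
    exact ⟨-n, by simp [hn]⟩

theorem mem_scaledLattice {V ι : Type*} [AddCommGroup V] [Module ℚ V] {v : Module.Basis ι ℚ V}
    {m : ℚ} {x : V} : x ∈ scaledLattice v m ↔ ∀ i, ∃ n : ℤ, v.repr x i = n * m := Iff.rfl

theorem isCosetReps_scaledLattice {V ι : Type*} [AddCommGroup V] [Module ℚ V] [Fintype ι]
    (v : Module.Basis ι ℚ V) {m : ℚ} (hm : m ≠ 0) {N : ℕ} (hN : 0 < N) :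
    IsCosetReps (scaledLattice v m) (scaledLattice v (N * m))
      fun x : ι → Fin N ↦ v.equivFun.symm fun i ↦ ((x i : ℕ) : ℚ) * m := by
  have hrepr : ∀ (y : ι → ℚ) i, v.repr (v.equivFun.symm y) i = y i := fun y i ↦ by
    rw [← Module.Basis.equivFun_apply, LinearEquiv.apply_symm_apply]
  have : NeZero N := ⟨hN.ne'⟩
  refine ⟨fun x i ↦ ⟨(x i : ℕ), by rw [hrepr]; push_cast; rfl⟩, fun x hx ↦ ?_⟩
  choose n hn using mem_scaledLattice.mp hx
  refine ⟨fun i ↦ ((Int.divModEquiv N) (n i)).2, fun i ↦ ?_, fun y hy ↦ funext fun i ↦ ?_⟩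
  · refine ⟨((Int.divModEquiv N) (n i)).1, ?_⟩
    have h := (Int.divModEquiv N).symm_apply_apply (n i)
    rw [Int.divModEquiv_symm_apply] at h
    rw [map_sub, Finsupp.sub_apply, hrepr, hn]
    conv_lhs => rw [← h]
    push_cast
    ring
  · obtain ⟨l, hl⟩ := hy i
    rw [map_sub, Finsupp.sub_apply, hrepr, hn] at hl
    have h1 : (n i : ℚ) = (l * N + (y i : ℕ) : ℤ) := by
      have : (n i - (y i : ℕ) - l * N : ℚ) * m = 0 := by linear_combination hl
      have := (mul_eq_zero.mp this).resolve_right hm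
      push_cast
      linear_combination this
    have h2 : n i = (Int.divModEquiv N).symm (l, y i) := by
      rw [Int.divModEquiv_symm_apply]
      exact_mod_cast h1
    rw [h2, Equiv.apply_symm_apply]

theorem prod_pos_mul_one_add_I {ι : Type*} [Fintype ι] (c : ι → ℚ) (hc : ∀ i, c i ≠ 0)
    (hsig : {i | 0 < c i}.ncard = {i | c i < 0}.ncard) (r : ι → ℝ) (hr : ∀ i, 0 < r i) :
    ∃ s : ℝ, 0 < s ∧
      ∏ i, ((r i : ℂ) * if 0 < c i then 1 + Complex.I else 1 - Complex.I) = s := by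
  classical
  have hpos := Finset.prod_pos fun i (_ : i ∈ Finset.univ) ↦ hr i
  refine ⟨(∏ i, r i) * 2 ^ {i | 0 < c i}.ncard, by positivity, ?_⟩
  rw [Finset.prod_mul_distrib, Finset.prod_ite, Finset.prod_const, Finset.prod_const]
  have h1 : (Finset.univ.filter fun i ↦ 0 < c i).card = {i | 0 < c i}.ncard := by
    rw [Set.ncard_eq_toFinset_card']; simp
  have h2 : (Finset.univ.filter fun i ↦ ¬ 0 < c i).card = {i | 0 < c i}.ncard := by
    rw [hsig, Set.ncard_eq_toFinset_card']
    congr 1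
    ext i
    simp [(hc i).le_iff_lt]
  rw [h1, h2, ← mul_pow, show (1 + Complex.I) * (1 - Complex.I) = 2 by
    linear_combination -Complex.I_sq]
  push_cast
  rfl

/-- Gauss sums of rational quadratic forms of signature zero are positive. -/
theorem exists_gauss_sum_eq_pos {V ι : Type*} [AddCommGroup V] [Module ℚ V] [Fintype ι]
    (v : Module.Basis ι ℚ V) (c : ι → ℚ) (hc : ∀ i, c i ≠ 0)
    (hsig : {i | 0 < c i}.ncard = {i | c i < 0}.ncard) (q : V → ℚ)
    (B : V →+ V →+ ℚ) (hq : ∀ x y, q (x + y) = q x + q y + B x y)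
    (hdiag : ∀ x, q x = ∑ i, c i * v.repr x i ^ 2) {Λ Λ₁ Λ₂ : AddSubgroup V}
    (hΛ : ∀ i, ∃ k : ℕ, 0 < k ∧ k • v i ∈ Λ)
    (h0 : ∀ x ∈ Λ, ∃ n : ℤ, q x = n) (h1 : dualLattice B Λ ≤ Λ₁) (h2 : Λ₂ ≤ Λ)
    (h12 : ∀ x ∈ Λ₁, ∀ y ∈ Λ₂, ∃ n : ℤ, B x y = n)
    {κ : Type*} [Fintype κ] {p : κ → V} (hp : IsCosetReps Λ₁ Λ₂ p) :
    ∃ r : ℝ, 0 < r ∧ ∑ i, ratExp (q (p i)) = r := by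
  classical
  have hB : ∀ x y, B x y = ∑ i, 2 * c i * v.repr x i * v.repr y i := fun x y ↦ by
    have h := hq x y
    simp only [hdiag, map_add, Finsupp.add_apply, ← Finset.sum_add_distrib] at h
    rw [← sub_eq_iff_eq_add', ← Finset.sum_sub_distrib] at h
    rw [← h]
    exact Finset.sum_congr rfl fun i _ ↦ by ring
  choose k hk hkΛ using hΛ
  have : Finite (dualLattice B Λ ⧸ Λ₂.addSubgroupOf (dualLattice B Λ)) :=
    hp.finite_quotient_bot h1
  have : Finite (dualLattice B Λ ⧸ Λ.addSubgroupOf (dualLattice B Λ)) :=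
    (IsCosetReps.exists_out (dualLattice B Λ) Λ₂).finite_quotient_top h2
  have := Fintype.ofFinite (dualLattice B Λ ⧸ Λ.addSubgroupOf (dualLattice B Λ))
  have hs := IsCosetReps.exists_out (dualLattice B Λ) Λ
  set s : dualLattice B Λ ⧸ Λ.addSubgroupOf (dualLattice B Λ) → V := fun x ↦ (x.out : V)
  obtain ⟨a, ha, h⟩ := exists_gauss_sum_eq_mul_discriminant q B hq h0 h1 h2 h12 hp hs
  -- a common denominator for the coordinates of the dual lattice
  set M : ℕ := 2 * (∏ i, k i) * ∏ i, (c i).num.natAbs with hM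
  set N : ℕ := 2 * M ^ 2 * ∏ i, (c i).den with hN
  have hnum : ∀ i, 0 < (c i).num.natAbs := fun i ↦
    Int.natAbs_pos.mpr (Rat.num_ne_zero.mpr (hc i))
  have hM0 : 0 < M := by
    have h1 := Finset.prod_pos fun i (_ : i ∈ Finset.univ) ↦ hk i
    have h2 := Finset.prod_pos fun i (_ : i ∈ Finset.univ) ↦ hnum i
    positivity
  have hden : 0 < ∏ i, (c i).den := Finset.prod_pos fun i (_ : i ∈ Finset.univ) ↦ (c i).pos
  have hN0 : 0 < N := by positivity
  have hMQ : (M : ℚ) ≠ 0 := by exact_mod_cast hM0.ne'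
  have hkM : ∀ i, ∃ l : ℕ, M = 2 * k i * (c i).num.natAbs * l := fun i ↦ by
    obtain ⟨l, hl⟩ := Finset.dvd_prod_of_mem k (Finset.mem_univ i)
    obtain ⟨l', hl'⟩ := Finset.dvd_prod_of_mem (fun i ↦ (c i).num.natAbs) (Finset.mem_univ i)
    exact ⟨l * l', by rw [hM, hl, hl']; ring⟩
  have hdN : ∀ i, ∃ l : ℕ, N = 2 * M ^ 2 * (c i).den * l := fun i ↦ by
    obtain ⟨l, hl⟩ := Finset.dvd_prod_of_mem (fun i ↦ (c i).den) (Finset.mem_univ i)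
    exact ⟨l, by rw [hN, hl]; ring⟩
  have hcabs : ∀ i, |c i| * (c i).den = (c i).num.natAbs := fun i ↦ by
    have h1 : c i * (c i).den = (c i).num := Rat.mul_den_eq_num _
    have h2 : ((c i).num.natAbs : ℚ) = |((c i).num : ℚ)| := by
      rw [← Int.cast_abs, Int.abs_eq_natAbs]; rfl
    rw [h2, ← h1, abs_mul, Nat.abs_cast]
  have hcden : ∀ i, ((c i).den : ℚ) ≠ 0 := fun i ↦ by exact_mod_cast (c i).den_ne_zero
  have hcnum : ∀ i, ((c i).num : ℚ) = c i * (c i).den := fun i ↦ (Rat.mul_den_eq_num _).symm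
  have g1 : dualLattice B Λ ≤ scaledLattice v (1 / M) := by
    intro x hx i
    obtain ⟨n, hn⟩ := hx _ (hkΛ i)
    obtain ⟨l, hl⟩ := hkM i
    rw [hB] at hn
    have : (M : ℚ) = 2 * k i * (c i).num.natAbs * l := by exact_mod_cast hl
    have hrepr : ∀ j, v.repr (k i • v i) j = if i = j then (k i : ℚ) else 0 := fun j ↦ by
      simp [Finsupp.single_apply]
    simp only [hrepr, mul_ite, mul_zero, Finset.sum_ite_eq, Finset.mem_univ, if_true] at hn
    obtain ⟨ε, hε⟩ : ∃ ε : ℤ, ((c i).num.natAbs : ℤ) = ε * (c i).num := by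
      rcases (c i).num.natAbs_eq with h | h
      · exact ⟨1, by rw [one_mul]; exact h.symm⟩
      · exact ⟨-1, by omega⟩
    have h4 : ((c i).num.natAbs : ℚ) = ε * (c i).num := by
      rw [← Int.cast_natCast (R := ℚ), hε, Int.cast_mul]
    refine ⟨n * (c i).den * l * ε, ?_⟩
    rw [mul_one_div, eq_div_iff hMQ, this, h4, hcnum]
    push_cast
    linear_combination ((c i).den * l * ε : ℚ) * hn
  have g2 : scaledLattice v (N * (1 / M)) ≤ Λ := by
    intro x hx
    rw [← v.sum_repr x]
    refine Λ.sum_mem fun i _ ↦ ?_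
    obtain ⟨n, hn⟩ := hx i
    obtain ⟨l, hl⟩ := hkM i
    generalize (c i).num.natAbs = w at hl
    have h3 : v.repr x i • v i =
        (n * (2 * (2 * w * l) * ∏ i, (c i).den : ℕ) : ℤ) • (k i • v i) := by
      rw [← Nat.cast_smul_eq_nsmul ℚ, ← Int.cast_smul_eq_zsmul ℚ, smul_smul, hn]
      congr 1
      rw [mul_one_div, ← mul_div_assoc, div_eq_iff hMQ]
      have : (M : ℚ) = 2 * k i * w * l := by exact_mod_cast hl
      rw [hN]
      push_cast
      rw [this]
      ring
    rw [h3]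
    exact Λ.zsmul_mem (hkΛ i) _
  have g12 : ∀ x ∈ scaledLattice v (1 / M), ∀ y ∈ scaledLattice v (N * (1 / M)),
      ∃ n : ℤ, B x y = n := by
    intro x hx y hy
    choose n hn using mem_scaledLattice.mp hx
    choose n' hn' using mem_scaledLattice.mp hy
    choose l hl using hdN
    refine ⟨∑ i, 4 * (c i).num * n i * n' i * l i, ?_⟩
    rw [hB]
    push_cast
    refine Finset.sum_congr rfl fun i _ ↦ ?_
    rw [hn, hn', hl i, hcnum]
    push_cast
    field_simp
    ring
  obtain ⟨b, hb, h'⟩ := exists_gauss_sum_eq_mul_discriminant q B hq h0 g1 g2 g12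
    (isCosetReps_scaledLattice v (by positivity) hN0) hs
  have hprod : ∑ x : ι → Fin N,
      ratExp (q (v.equivFun.symm fun i ↦ ((x i : ℕ) : ℚ) * (1 / M))) =
      ∏ i, ∑ x ∈ Finset.range N, ratExp (c i / M ^ 2 * (x : ℚ) ^ 2) := by
    simp only [Finset.sum_range]
    rw [Finset.prod_univ_sum, Fintype.piFinset_univ]
    refine Finset.sum_congr rfl fun x _ ↦ ?_
    rw [hdiag, ratExp_sum]
    refine Finset.prod_congr rfl fun i _ ↦ ?_
    rw [← Module.Basis.equivFun_apply, LinearEquiv.apply_symm_apply]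
    congr 1
    ring
  have hone : ∀ i, ∃ r : ℝ, 0 < r ∧
      ∑ x ∈ Finset.range N, ratExp (c i / M ^ 2 * (x : ℚ) ^ 2) =
        r * if 0 < c i then 1 + Complex.I else 1 - Complex.I := fun i ↦ by
    obtain ⟨l, hl⟩ := hkM i
    obtain ⟨l', hl'⟩ := hdN i
    have hiff : 0 < c i / (M : ℚ) ^ 2 ↔ 0 < c i := by
      rw [div_pos_iff_of_pos_right (by positivity)]
    have := exists_pos_sum_ratExp_mul_sq (c := c i / M ^ 2) (N := N)
      (n := k i ^ 2 * (c i).num.natAbs * l ^ 2 * (c i).den) (k := 2 * (c i).num.natAbs * l')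
      (div_ne_zero (hc i) (by positivity)) ?_ ?_ hN0
    · simpa only [hiff] using this
    · rw [abs_div, abs_of_pos (by positivity : (0 : ℚ) < (M : ℚ) ^ 2), div_mul_eq_mul_div,
        div_eq_one_iff_eq (by positivity)]
      have : (M : ℚ) = 2 * k i * (c i).num.natAbs * l := by exact_mod_cast hl
      rw [this]
      push_cast
      linear_combination (4 * (k i : ℚ) ^ 2 * (c i).num.natAbs * l ^ 2) * hcabs i
    · rw [hl', hl]; ring
  choose r hr hr' using hone
  obtain ⟨t, ht, ht'⟩ := prod_pos_mul_one_add_I c hc hsig r hr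
  rw [hprod, Finset.prod_congr rfl fun i _ ↦ hr' i, ht'] at h'
  have hbC : (b : ℂ) ≠ 0 := by exact_mod_cast hb.ne'
  have haR : (0 : ℝ) < a := by exact_mod_cast ha
  have hbR : (0 : ℝ) < b := by exact_mod_cast hb
  refine ⟨a * (t / b), by positivity, ?_⟩
  rw [h]
  push_cast
  rw [h', mul_div_cancel_left₀ _ hbC]

section Signature

/-- The form `y ↦ L (ω * y ^ 2)` on an algebra `W`. -/
noncomputable def scaledSquareForm {W : Type*} [CommRing W] [Algebra ℝ W] (L : W →ₗ[ℝ] ℝ) (ω : W) :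
    QuadraticForm ℝ W :=
  LinearMap.BilinMap.toQuadraticMap
    ((LinearMap.mul ℝ W).compr₂ (L ∘ₗ LinearMap.mulLeft ℝ ω))

theorem scaledSquareForm_apply {W : Type*} [CommRing W] [Algebra ℝ W] (L : W →ₗ[ℝ] ℝ) (ω y : W) :
    scaledSquareForm L ω y = L (ω * (y * y)) := by
  simp [scaledSquareForm]

theorem sigPos_scaledSquareForm_mul_sq {W : Type*} [CommRing W] [Algebra ℝ W] (L : W →ₗ[ℝ] ℝ)
    (ω : W) (s : Wˣ) :
    sigPos (scaledSquareForm L (s ^ 2 * ω)) =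
      sigPos (scaledSquareForm L ω) := by
  refine QuadraticMap.Equivalent.sigPos_eq ⟨⟨DistribMulAction.toLinearEquiv ℝ W s, fun y ↦ ?_⟩⟩
  simp only [scaledSquareForm_apply]
  congr 1
  change ω * (s • y * s • y) = _
  simp only [Units.smul_def, smul_eq_mul]
  ring

theorem ncard_pos_trace_eq_sigPos {K W ι : Type*} [Field K] [NumberField K] [CommRing W]
    [Algebra ℝ W] [Fintype ι] [DecidableEq ι] (j : K →+* W) {L : W →ₗ[ℝ] ℝ}
    (hL : ∀ x, L (j x) = Algebra.trace ℚ K x) (v : ι → K) (v' : Module.Basis ι ℝ W)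
    (hv : ∀ i, v' i = j (v i)) (ω : K)
    (hω : ∀ i k, i ≠ k → Algebra.trace ℚ K (ω * (v i * v k)) = 0) :
    {i | 0 < Algebra.trace ℚ K (ω * (v i * v i))}.ncard = 
      sigPos (scaledSquareForm L (j ω)) := by
  have hB : (QuadraticMap.associated (R := ℝ) (scaledSquareForm L (j ω))).IsOrthoᵢ v' := by
    rw [scaledSquareForm, QuadraticMap.associated_left_inverse]
    · intro i k hik
      simp only [LinearMap.compr₂_apply, LinearMap.mul_apply', LinearMap.comp_apply,
        LinearMap.mulLeft_apply, hv, ← map_mul, hL, hω i k hik, Rat.cast_zero, Function.onFun]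
    · intro x y
      simp [mul_comm x y]
  rw [QuadraticForm.sigPos_of_equiv_weightedSumSquares
    (w := fun i ↦ scaledSquareForm L (j ω) (v' i))]
  · simp only [scaledSquareForm_apply, hv, ← map_mul, hL, Rat.cast_pos]
  · have := (scaledSquareForm L (j ω)).isometryEquivBasisRepr v'
    rw [QuadraticMap.basisRepr_eq_of_iIsOrtho _ _ hB] at this
    exact ⟨this⟩

theorem mixedEmbedding_rat_smul {K : Type*} [Field K] (r : ℚ) (y : K) [NumberField K] :
    mixedEmbedding K (r • y) = (r : ℝ) • mixedEmbedding K y := by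
  refine Prod.ext (funext fun w ↦ ?_) (funext fun w ↦ ?_)
  · simp [Algebra.smul_def]
  · simp [Algebra.smul_def]

open mixedEmbedding in
theorem exists_trace_extension (K : Type*) [Field K] [NumberField K] :
    ∃ L : mixedSpace K →ₗ[ℝ] ℝ, ∀ x, L (mixedEmbedding K x) = Algebra.trace ℚ K x := by
  refine ⟨(latticeBasis K).constr ℝ fun i ↦ (Algebra.trace ℚ K (integralBasis K i) : ℝ),
    fun x ↦ ?_⟩
  conv_lhs => rw [← (integralBasis K).sum_repr x]
  conv_rhs => rw [← (integralBasis K).sum_repr x]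
  simp only [map_sum, mixedEmbedding_rat_smul, map_smul, ← latticeBasis_apply, Module.Basis.constr_basis, smul_eq_mul,
    Rat.cast_sum, Rat.cast_mul]

open mixedEmbedding in
theorem exists_mixedSpace_basis {K : Type*} [Field K] [NumberField K] {ι : Type*} [Fintype ι]
    (v : Module.Basis ι ℚ K) :
    ∃ v' : Module.Basis ι ℝ (mixedSpace K), ∀ i, v' i = mixedEmbedding K (v i) := by
  refine ⟨basisOfTopLeSpanOfCardEqFinrank (fun i ↦ mixedEmbedding K (v i)) ?_ ?_, fun i ↦
    congrFun (coe_basisOfTopLeSpanOfCardEqFinrank _ _ _) i⟩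
  · rw [← (latticeBasis K).span_eq, Submodule.span_le]
    rintro _ ⟨i, rfl⟩
    rw [latticeBasis_apply, ← v.sum_repr (integralBasis K i), map_sum]
    refine Submodule.sum_mem _ fun k _ ↦ ?_
    rw [mixedEmbedding_rat_smul]
    exact Submodule.smul_mem _ _ (Submodule.subset_span ⟨k, rfl⟩)
  · rw [mixedEmbedding.finrank, Module.finrank_eq_card_basis v]

open mixedEmbedding in
theorem exists_unit_sq_eq_mixedEmbedding {K : Type*} [Field K] [NumberField K] {a : K} (ha : a ≠ 0)
    (hpos : ∀ σ : K →+* ℝ, 0 < σ a) : ∃ s : (mixedSpace K)ˣ, (s : mixedSpace K) ^ 2 =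
      mixedEmbedding K a := by
  have h1 : ∀ w : {w : InfinitePlace K // w.IsComplex}, ∃ z : ℂ, z ^ 2 = w.1.embedding a :=
    fun w ↦ IsAlgClosed.exists_pow_nat_eq _ two_pos
  choose z hz using h1
  let s : mixedSpace K :=
    (fun w ↦ Real.sqrt (InfinitePlace.embedding_of_isReal w.2 a), z)
  have hs : s ^ 2 = mixedEmbedding K a := by
    refine Prod.ext (funext fun w ↦ ?_) (funext fun w ↦ ?_)
    · rw [mixedEmbedding_apply_isReal]
      exact Real.sq_sqrt (hpos _).le
    · rw [mixedEmbedding_apply_isComplex]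
      exact hz w
  have hu : IsUnit s := by
    rw [← isUnit_pow_iff two_ne_zero, hs]
    exact (isUnit_iff_ne_zero.mpr ha).map _
  exact ⟨hu.unit, hs⟩

theorem exists_orthogonal_basis_trace {K : Type*} [Field K] [NumberField K] {ω : K} (hω : ω ≠ 0) :
    ∃ v : Module.Basis (Fin (Module.finrank ℚ K)) ℚ K,
      (∀ i k, i ≠ k → Algebra.trace ℚ K (ω * (v i * v k)) = 0) ∧
      ∀ i, Algebra.trace ℚ K (ω * (v i * v i)) ≠ 0 := by
  let B : LinearMap.BilinForm ℚ K :=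
    (LinearMap.mul ℚ K).compr₂ (Algebra.trace ℚ K ∘ₗ LinearMap.mulLeft ℚ ω)
  have hB : ∀ x y, B x y = Algebra.trace ℚ K (ω * (x * y)) := fun x y ↦ by simp [B]
  obtain ⟨v, hv⟩ := LinearMap.BilinForm.exists_orthogonal_basis (B := B)
    ⟨fun x y ↦ by simp [hB, mul_comm x y]⟩
  refine ⟨v, fun i k hik ↦ ?_, fun i ↦ ?_⟩
  · rw [← hB]
    exact hv hik
  · rw [← hB]
    refine hv.not_isOrtho_basis_self_of_separatingLeft (fun x hx ↦ ?_) i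
    have : ω * x = 0 := (traceForm_nondegenerate ℚ K).1 (ω * x) fun y ↦ by
      rw [Algebra.traceForm_apply, mul_assoc, ← hB, hx]
    simpa [hω] using this

theorem exists_diagonal_norm_form {K : Type*} [Field K] [NumberField K] {ω a : K} (hω : ω ≠ 0)
    (ha : a ≠ 0) (hpos : ∀ σ : K →+* ℝ, 0 < σ a) :
    ∃ (v : Module.Basis (Fin (Module.finrank ℚ K) ⊕ Fin (Module.finrank ℚ K)) ℚ (K × K))
      (c : Fin (Module.finrank ℚ K) ⊕ Fin (Module.finrank ℚ K) → ℚ), (∀ i, c i ≠ 0) ∧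
      {i | 0 < c i}.ncard = {i | c i < 0}.ncard ∧
      ∀ x : K × K, Algebra.trace ℚ K (ω * (x.1 ^ 2 - a * x.2 ^ 2)) =
        ∑ i, c i * v.repr x i ^ 2 := by
  obtain ⟨v, hv, hv0⟩ := exists_orthogonal_basis_trace hω
  obtain ⟨v', hv', hv0'⟩ := exists_orthogonal_basis_trace (mul_ne_zero ha hω)
  have hdiag : ∀ {ω : K} {v : Module.Basis (Fin (Module.finrank ℚ K)) ℚ K}
      (_ : ∀ i k, i ≠ k → Algebra.trace ℚ K (ω * (v i * v k)) = 0) (x : K),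
      Algebra.trace ℚ K (ω * x ^ 2) =
        ∑ i, Algebra.trace ℚ K (ω * (v i * v i)) * v.repr x i ^ 2 := by
    intro ω v hv x
    conv_lhs => rw [← v.sum_repr x]
    rw [sq, Finset.sum_mul_sum, Finset.mul_sum, map_sum]
    refine Finset.sum_congr rfl fun i _ ↦ ?_
    rw [Finset.mul_sum, map_sum, Finset.sum_eq_single i]
    · rw [smul_mul_smul_comm, mul_smul_comm, map_smul, smul_eq_mul]
      ring
    · intro k _ hk
      rw [smul_mul_smul_comm, mul_smul_comm, map_smul, hv i k hk.symm, smul_zero]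
    · simp
  have hsig : {i | 0 < Algebra.trace ℚ K (ω * (v i * v i))}.ncard =
      {i | 0 < Algebra.trace ℚ K (a * ω * (v' i * v' i))}.ncard := by
    obtain ⟨L, hL⟩ := exists_trace_extension K
    obtain ⟨w, hw⟩ := exists_mixedSpace_basis v
    obtain ⟨w', hw'⟩ := exists_mixedSpace_basis v'
    obtain ⟨s, hs⟩ := exists_unit_sq_eq_mixedEmbedding ha hpos
    rw [ncard_pos_trace_eq_sigPos (mixedEmbedding K) hL v w hw ω hv,
      ncard_pos_trace_eq_sigPos (mixedEmbedding K) hL v' w' hw' _ hv', map_mul (mixedEmbedding K), ← hs,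
      sigPos_scaledSquareForm_mul_sq]
  have hcompl : ∀ {n : ℕ} {f : Fin n → ℚ} (_ : ∀ i, f i ≠ 0),
      {i | 0 < f i}.ncard + {i | f i < 0}.ncard = n := by
    intro n f hf
    have : {i | f i < 0} = {i | 0 < f i}ᶜ := by
      ext i
      simp [(hf i).le_iff_lt]
    rw [this, Set.ncard_add_ncard_compl, Nat.card_fin]
  refine ⟨v.prod v', Sum.elim (fun i ↦ Algebra.trace ℚ K (ω * (v i * v i)))
    (fun i ↦ -Algebra.trace ℚ K (a * ω * (v' i * v' i))), ?_, ?_, ?_⟩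
  · rintro (i | i)
    · exact hv0 i
    · exact neg_ne_zero.mpr (hv0' i)
  · have hsum : ∀ {n : ℕ} (p : Fin n ⊕ Fin n → Prop),
        {i | p i}.ncard = {i | p (Sum.inl i)}.ncard + {i | p (Sum.inr i)}.ncard := by
      intro n p
      classical
      simp only [Set.ncard_eq_toFinset_card', Set.toFinset_ofPred, Finset.card_filter,
        Fintype.sum_sum_type]
    rw [hsum, hsum]
    simp only [Sum.elim_inl, Sum.elim_inr, Left.neg_pos_iff, Left.neg_neg_iff]
    have := hcompl hv0
    have := hcompl hv0'
    omega
  · intro x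
    rw [Fintype.sum_sum_type]
    simp only [Sum.elim_inl, Sum.elim_inr, Module.Basis.prod_repr_inl, Module.Basis.prod_repr_inr,
      neg_mul, Finset.sum_neg_distrib]
    rw [← hdiag hv, ← hdiag hv', mul_sub, map_sub, sub_eq_add_neg]
    congr 3
    ring

end Signature

section NormForm

theorem exists_sq_sub_mul_sq_eq {F : Type*} [Field F] [Finite F] (h2 : (2 : F) ≠ 0) {a : F}
    (ha : a ≠ 0) (b : F) : ∃ x y : F, x ^ 2 - a * y ^ 2 = b := by
  have := Fintype.ofFinite F
  have hF : ringChar F ≠ 2 := fun h ↦ h2 (by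
    have := ringChar.Nat.cast_ringChar (R := F)
    rw [h] at this
    exact_mod_cast this)
  obtain ⟨x, y, h⟩ := FiniteField.exists_root_sum_quadratic
    (f := Polynomial.C 1 * Polynomial.X ^ 2 + Polynomial.C 0 * Polynomial.X + Polynomial.C (-b))
    (g := Polynomial.C (-a) * Polynomial.X ^ 2 + Polynomial.C 0 * Polynomial.X + Polynomial.C 0)
    (Polynomial.degree_quadratic one_ne_zero) (Polynomial.degree_quadratic (neg_ne_zero.mpr ha))
    (FiniteField.odd_card_of_char_ne_two hF)
  simp only [Polynomial.eval_add, Polynomial.eval_mul, Polynomial.eval_C, Polynomial.eval_pow,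
    Polynomial.eval_X] at h
  exact ⟨x, y, by linear_combination h⟩

theorem exists_norm_form_eq_of_field {F : Type*} [Field F] [Finite F] {m b k : F}
    (hb : b - 1 = 2 * (1 + 4 * m) * k) : ∃ s t : F, s ^ 2 + s * t - m * t ^ 2 = b := by
  by_cases h2 : (2 : F) = 0
  · exact ⟨1, 0, by linear_combination -hb - (1 + 4 * m) * k * h2⟩
  by_cases ha : (1 + 4 * m) = 0
  · exact ⟨1, 0, by linear_combination -hb - 2 * k * ha⟩
  obtain ⟨x, y, h⟩ := exists_sq_sub_mul_sq_eq h2 ha b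
  exact ⟨x - y, 2 * y, by linear_combination h⟩

theorem exists_norm_form_eq {A : Type*} [CommRing A] [Finite A] {m b k : A}
    (hb : b - 1 = 2 * (1 + 4 * m) * k) (hu : IsUnit b) :
    ∃ s t : A, s ^ 2 + s * t - m * t ^ 2 = b := by
  have hloc : ∀ I : MaximalSpectrum A, ∃ z : (A ⧸ I.asIdeal) × (A ⧸ I.asIdeal),
      z.1 ^ 2 + z.1 * z.2 - algebraMap A _ m * z.2 ^ 2 = algebraMap A _ b := by
    intro I
    have : I.asIdeal.IsMaximal := I.isMaximal
    let := Ideal.Quotient.field I.asIdeal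
    have : Finite (A ⧸ I.asIdeal) := Finite.of_surjective _ Ideal.Quotient.mk_surjective
    obtain ⟨s, t, h⟩ := exists_norm_form_eq_of_field (F := A ⧸ I.asIdeal)
      (m := algebraMap A _ m) (b := algebraMap A _ b) (k := algebraMap A _ k) (by
        have := congrArg (algebraMap A (A ⧸ I.asIdeal)) hb
        simpa only [map_sub, map_mul, map_add, map_one, map_ofNat] using this)
    exact ⟨(s, t), h⟩
  choose z hz using hloc
  let E := IsArtinianRing.quotNilradicalEquivPi A
  have hE : ∀ (x : A) (I : MaximalSpectrum A),
      E (algebraMap A _ x) I = algebraMap A (A ⧸ I.asIdeal) x := fun x I ↦ by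
    rw [AlgEquiv.commutes]
    rfl
  obtain ⟨s, hs⟩ := Ideal.Quotient.mk_surjective (E.symm fun I ↦ (z I).1)
  obtain ⟨t, ht⟩ := Ideal.Quotient.mk_surjective (E.symm fun I ↦ (z I).2)
  have hs' : ∀ I : MaximalSpectrum A, algebraMap A (A ⧸ I.asIdeal) s = (z I).1 := fun I ↦ by
    rw [← hE]
    exact congrFun (E.eq_symm_apply.mp hs) I
  have ht' : ∀ I : MaximalSpectrum A, algebraMap A (A ⧸ I.asIdeal) t = (z I).2 := fun I ↦ by
    rw [← hE]
    exact congrFun (E.eq_symm_apply.mp ht) I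
  have hnil : IsNilpotent (s ^ 2 + s * t - m * t ^ 2 - b) := by
    rw [← mem_nilradical, ← Ideal.Quotient.eq_zero_iff_mem]
    apply E.injective
    rw [map_zero]
    funext I
    have := hE (s ^ 2 + s * t - m * t ^ 2 - b) I
    refine this.trans ?_
    simp only [map_sub, map_add, map_mul, map_pow, hs', ht', hz, sub_self, Pi.zero_apply]
  obtain ⟨u, hu'⟩ : IsUnit (s ^ 2 + s * t - m * t ^ 2) := by
    have := hnil.isUnit_add_left_of_commute hu (mul_comm _ _)
    simpa using this
  have hν : IsNilpotent (b * ↑u⁻¹ - 1) := by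
    have : b * ↑u⁻¹ - 1 = -((s ^ 2 + s * t - m * t ^ 2 - b) * ↑u⁻¹) := by
      rw [← hu', sub_mul, Units.mul_inv]
      ring
    rw [this]
    exact ((Commute.all _ _).isNilpotent_mul_right hnil).neg
  obtain ⟨r, ⟨-, hr⟩, -⟩ := Polynomial.existsUnique_nilpotent_sub_and_aeval_eq_zero (R := A) (S := A)
    (P := Polynomial.C (-m) * Polynomial.X ^ 2 + Polynomial.X - Polynomial.C (b * ↑u⁻¹ - 1))
    (x := 0) (by simpa using hν.neg) (by simp)
  simp only [Polynomial.aeval_sub, Polynomial.aeval_add, Polynomial.aeval_mul, Polynomial.aeval_X,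
    Polynomial.aeval_C, Algebra.algebraMap_self, RingHom.id_apply, map_pow] at hr
  have hub : (u : A) * (b * ↑u⁻¹) = b := by
    rw [mul_left_comm, Units.mul_inv, mul_one]
  refine ⟨s + m * t * r, s * r + t + t * r, ?_⟩
  linear_combination u * hr + hub - (1 + r - m * r ^ 2) * hu'

/-- A sum over pairs of a character composed with a norm form is unchanged when the form is
multiplied by a unit that it represents. -/
theorem sum_norm_form_mul {A : Type*} [CommRing A] [Fintype A] {m b s t : A}
    (h : s ^ 2 + s * t - m * t ^ 2 = b) (hu : IsUnit b) (f : A → ℂ) :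
    ∑ z : A × A, f (b * (z.1 ^ 2 + z.1 * z.2 - m * z.2 ^ 2)) =
      ∑ z : A × A, f (z.1 ^ 2 + z.1 * z.2 - m * z.2 ^ 2) := by
  let g : A × A → A × A := fun z ↦ (s * z.1 + m * t * z.2, s * z.2 + t * z.1 + t * z.2)
  have hg : Function.Injective g := by
    rintro ⟨x, y⟩ ⟨x', y'⟩ hxy
    obtain ⟨h1, h2⟩ := Prod.mk.inj hxy
    refine Prod.ext (hu.mul_left_cancel ?_) (hu.mul_left_cancel ?_)
    · rw [← h]
      linear_combination (s + t) * h1 - m * t * h2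
    · rw [← h]
      linear_combination s * h2 - t * h1
  refine Fintype.sum_bijective g (Finite.injective_iff_bijective.mp hg) _ _ fun z ↦ ?_
  congr 1
  rw [← h]
  ring

theorem sum_comp_sq_add_sum_comp_mul_sq {F : Type*} [Field F] [Fintype F] [DecidableEq F]
    (hF : ringChar F ≠ 2) {a : F} (ha : ¬IsSquare a) (f : F → ℂ) :
    ∑ x, f (x ^ 2) + ∑ x, f (a * x ^ 2) = 2 * ∑ x, f x := by
  have ha0 : a ≠ 0 := by
    rintro rfl
    exact ha (IsSquare.zero)
  have h1 : ∀ g : F → ℂ, ∑ x, g (x ^ 2) = ∑ c, ((quadraticChar F c : ℤ) + 1 : ℂ) * g c := by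
    intro g
    rw [← Finset.sum_fiberwise (s := Finset.univ) (g := fun x : F ↦ x ^ 2)]
    refine Finset.sum_congr rfl fun c _ ↦ ?_
    rw [Finset.sum_congr rfl (g := fun _ ↦ g c) fun x hx ↦ by rw [(Finset.mem_filter.mp hx).2],
      Finset.sum_const, nsmul_eq_mul]
    congr 1
    have := quadraticChar_card_sqrts hF c
    rw [Set.toFinset_ofPred] at this
    exact_mod_cast this
  have h2 : ∑ x, f (a * x ^ 2) = ∑ c, (-(quadraticChar F c : ℤ) + 1 : ℂ) * f c := by
    rw [h1 fun x ↦ f (a * x)]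
    refine Fintype.sum_bijective (a * ·) (mulLeft_bijective₀ a ha0) _ _ fun c ↦ ?_
    rw [map_mul, quadraticChar_neg_one_iff_not_isSquare.mpr ha]
    push_cast
    ring
  rw [h1, h2, ← Finset.sum_add_distrib, Finset.mul_sum]
  exact Finset.sum_congr rfl fun c _ ↦ by ring

/-- The Gauss sum of a norm form attached to a nonsquare is a nonpositive real number. -/
theorem sum_norm_form_eq_neg_normSq {F : Type*} [Field F] [Finite F] {ι : Type*} [Fintype ι]
    (h2 : (2 : F) ≠ 0) {m : F} (ha : ¬IsSquare (1 + 4 * m)) {ψ : AddChar F ℂ} (hψ : ψ ≠ 1)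
    (e : ι ≃ F × F) :
    ∃ r : ℝ, 0 ≤ r ∧
      ∑ i, ψ ((e i).1 ^ 2 + (e i).1 * (e i).2 - m * (e i).2 ^ 2) = (-r : ℝ) := by
  classical
  have := Fintype.ofFinite F
  have hF : ringChar F ≠ 2 := fun h ↦ h2 (by
    have := ringChar.Nat.cast_ringChar (R := F)
    rw [h] at this
    exact_mod_cast this)
  have h := sum_comp_sq_add_sum_comp_mul_sq hF ha ψ
  rw [AddChar.sum_eq_zero_of_ne_one hψ, mul_zero] at h
  have hbij : Function.Bijective fun z : F × F ↦ (z.1 - z.2, 2 * z.2) := by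
    refine Finite.injective_iff_bijective.mp ?_
    rintro ⟨x, y⟩ ⟨x', y'⟩ hxy
    obtain ⟨h1, h3⟩ := Prod.mk.inj hxy
    have h4 := mul_left_cancel₀ h2 h3
    exact Prod.ext (by linear_combination h1 + h4) h4
  refine ⟨Complex.normSq (∑ x, ψ (x ^ 2)), Complex.normSq_nonneg _, ?_⟩
  rw [e.sum_comp fun z ↦ ψ (z.1 ^ 2 + z.1 * z.2 - m * z.2 ^ 2),
    ← hbij.sum_comp fun z ↦ ψ (z.1 ^ 2 + z.1 * z.2 - m * z.2 ^ 2)]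
  have h5 : ∀ z : F × F, ψ ((z.1 - z.2) ^ 2 + (z.1 - z.2) * (2 * z.2) - m * (2 * z.2) ^ 2) =
      ψ (z.1 ^ 2) * starRingEnd ℂ (ψ ((1 + 4 * m) * z.2 ^ 2)) := by
    intro z
    rw [← AddChar.map_neg_eq_conj, ← AddChar.map_add_eq_mul]
    congr 1
    ring
  simp only [h5]
  rw [Fintype.sum_prod_type]
  simp only [← Finset.mul_sum]
  rw [← Finset.sum_mul, ← map_sum (starRingEnd ℂ), eq_neg_of_add_eq_zero_right h, map_neg, mul_neg,
    Complex.mul_conj]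
  push_cast
  rfl

end NormForm

section TraceSums

/-- The lattice `g • (𝓞 K × 𝓞 K)` in `K × K`. -/
def integerLattice {K : Type*} [Field K] (g : K) : AddSubgroup (K × K) where
  carrier := {z | ∃ x y : 𝓞 K, z = (g * x, g * y)}
  zero_mem' := ⟨0, 0, Prod.ext (by simp) (by simp)⟩
  add_mem' := by
    rintro _ _ ⟨x, y, rfl⟩ ⟨x', y', rfl⟩
    exact ⟨x + x', y + y', by simp [mul_add]⟩
  neg_mem' := by
    rintro _ ⟨x, y, rfl⟩
    exact ⟨-x, -y, by simp⟩

theorem isCosetReps_integerLattice {K : Type*} [Field K] (g : 𝓞 K) :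
    IsCosetReps (integerLattice (1 : K)) (integerLattice (g : K))
      (fun z : (𝓞 K ⧸ Ideal.span {g}) × (𝓞 K ⧸ Ideal.span {g}) ↦
        (((Quotient.out z.1 : 𝓞 K) : K), ((Quotient.out z.2 : 𝓞 K) : K))) := by
  have key : ∀ (x : 𝓞 K) (z : 𝓞 K ⧸ Ideal.span {g}),
      z = Ideal.Quotient.mk _ x ↔ ∃ k : 𝓞 K, (x : K) - (Quotient.out z : 𝓞 K) = g * k := by
    intro x z
    have h : z = Ideal.Quotient.mk _ (Quotient.out z) := (Quotient.out_eq z).symm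
    conv_lhs => rw [h, eq_comm, Ideal.Quotient.mk_eq_mk_iff_sub_mem, Ideal.mem_span_singleton]
    refine exists_congr fun k ↦ ?_
    rw [← RingOfIntegers.coe_injective.eq_iff]
    push_cast
    rfl
  refine ⟨fun z ↦ ⟨Quotient.out z.1, Quotient.out z.2, by simp⟩, ?_⟩
  rintro _ ⟨x, y, rfl⟩
  refine ⟨(Ideal.Quotient.mk _ x, Ideal.Quotient.mk _ y), ?_, ?_⟩
  · obtain ⟨k, hk⟩ := (key x _).mp rfl
    obtain ⟨l, hl⟩ := (key y _).mp rfl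
    exact ⟨k, l, by simpa using ⟨hk, hl⟩⟩
  · rintro ⟨z, w⟩ ⟨k, l, h⟩
    obtain ⟨h1, h2⟩ := Prod.mk.inj h
    exact Prod.ext ((key x z).mpr ⟨k, by simpa using h1⟩) ((key y w).mpr ⟨l, by simpa using h2⟩)

variable {K : Type*} [Field K] [NumberField K]

open nonZeroDivisors in
/-- For every proper principal ideal `(b)` there are elements `δ` of the inverse different and
`u` of the different whose product is not divisible by `b`. -/
theorem exists_mul_inverse_different_not_dvd {b : 𝓞 K} (hb : ¬IsUnit b) :
    ∃ (u δ : K) (t : 𝓞 K), (t : K) = u * δ ∧ ¬b ∣ t ∧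
      (∀ x : 𝓞 K, ∃ n : ℤ, Algebra.trace ℚ K (δ * x) = n) ∧
      ∀ y : K, (∀ x : 𝓞 K, ∃ n : ℤ, Algebra.trace ℚ K (y * x) = n) → ∃ z : 𝓞 K, (z : K) = u * y := by
  let I : FractionalIdeal (𝓞 K)⁰ K := FractionalIdeal.dual ℤ ℚ 1
  have hI1 : (1 : FractionalIdeal (𝓞 K)⁰ K) ≠ 0 := one_ne_zero
  have hI0 : I ≠ 0 := FractionalIdeal.dual_ne_zero ℤ ℚ hI1
  have hI : ∀ y : K, y ∈ I ↔ ∀ x : 𝓞 K, ∃ n : ℤ, Algebra.trace ℚ K (y * x) = n := by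
    intro y
    rw [FractionalIdeal.mem_dual hI1]
    constructor
    · intro h x
      obtain ⟨n, hn⟩ := h x ((FractionalIdeal.mem_one_iff _).mpr ⟨x, rfl⟩)
      exact ⟨n, hn.symm⟩
    · intro h x hx
      obtain ⟨x, rfl⟩ := (FractionalIdeal.mem_one_iff _).mp hx
      obtain ⟨n, hn⟩ := h x
      exact ⟨n, hn.symm⟩
  have hmul : I⁻¹ * I = 1 := inv_mul_cancel₀ hI0
  by_contra! hcon
  have hle : I⁻¹ * I ≤ FractionalIdeal.spanSingleton (𝓞 K)⁰ (b : K) := by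
    rw [FractionalIdeal.mul_le]
    intro u hu δ hδ
    have hu' : ∀ y ∈ I, ∃ z : 𝓞 K, (z : K) = u * y := fun y hy ↦ by
      have := FractionalIdeal.mul_mem_mul hu hy
      rw [hmul, FractionalIdeal.mem_one_iff] at this
      exact this
    obtain ⟨t, ht⟩ := hu' δ hδ
    have hbt : b ∣ t := by
      by_contra hbt
      obtain ⟨y, hy, hy'⟩ := hcon u δ t ht hbt ((hI δ).mp hδ)
      obtain ⟨z, hz⟩ := hu' y ((hI y).mpr hy)
      exact hy' z hz
    obtain ⟨k, rfl⟩ := hbt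
    rw [FractionalIdeal.mem_spanSingleton]
    refine ⟨k, ?_⟩
    rw [← ht, Algebra.smul_def, mul_comm, ← map_mul]
  rw [hmul] at hle
  have h1 := hle (FractionalIdeal.one_mem_one _)
  obtain ⟨k, hk⟩ := (FractionalIdeal.mem_spanSingleton _).mp h1
  refine hb (IsUnit.of_mul_eq_one k (RingOfIntegers.coe_injective ?_))
  rw [Algebra.smul_def, mul_comm, ← map_mul] at hk
  simpa using hk

theorem exists_addChar_trace {δ : K} (hδ : ∀ x : 𝓞 K, ∃ n : ℤ, Algebra.trace ℚ K (δ * x) = n)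
    {g : 𝓞 K} (hg : g ≠ 0) :
    ∃ ψ : AddChar (𝓞 K ⧸ Ideal.span {g}) ℂ, ∀ x : 𝓞 K,
      ψ (Ideal.Quotient.mk _ x) = ratExp (Algebra.trace ℚ K (δ * x / g)) := by
  have hg' : (g : K) ≠ 0 := by simpa using hg
  let f : 𝓞 K → ℂ := fun x ↦ ratExp (Algebra.trace ℚ K (δ * x / g))
  have hadd : ∀ x y, f (x + y) = f x * f y := fun x y ↦ by
    simp only [f, ← ratExp_add, ← map_add]
    congr 2
    push_cast
    ring
  have hper : ∀ x y, Ideal.Quotient.mk (Ideal.span {g}) x = Ideal.Quotient.mk _ y → f x = f y := by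
    intro x y h
    rw [Ideal.Quotient.mk_eq_mk_iff_sub_mem, Ideal.mem_span_singleton] at h
    obtain ⟨k, hk⟩ := h
    obtain rfl : x = y + g * k := by linear_combination hk
    rw [hadd]
    have : f (g * k) = 1 := by
      obtain ⟨n, hn⟩ := hδ k
      rw [← ratExp_intCast n, ← hn]
      simp only [f]
      congr 2
      push_cast
      field_simp
    rw [this, mul_one]
  have hout : ∀ x : 𝓞 K, f (Quotient.out (Ideal.Quotient.mk (Ideal.span {g}) x)) = f x :=
    fun x ↦ hper _ _ (Quotient.out_eq _)
  refine ⟨⟨fun x ↦ f (Quotient.out x), ?_, ?_⟩, hout⟩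
  · rw [← map_zero (Ideal.Quotient.mk (Ideal.span {g})), hout]
    simp [f, ratExp_zero]
  · intro x y
    obtain ⟨x, rfl⟩ := Ideal.Quotient.mk_surjective x
    obtain ⟨y, rfl⟩ := Ideal.Quotient.mk_surjective y
    rw [← map_add, hout, hout, hout, hadd]

/-- The polar form of `z ↦ Tr (ω * (z.1 ^ 2 + z.1 * z.2 - m * z.2 ^ 2))`. -/
noncomputable def tracePolar (ω m : K) : K × K →+ K × K →+ ℚ :=
  AddMonoidHom.mk' (fun z ↦ AddMonoidHom.mk' (fun w ↦ Algebra.trace ℚ K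
    (ω * ((2 * z.1 + z.2) * w.1 + (z.1 - 2 * m * z.2) * w.2)))
    fun w w' ↦ by rw [← map_add]; congr 1; simp only [Prod.fst_add, Prod.snd_add]; ring)
    fun z z' ↦ by
      ext w
      simp only [AddMonoidHom.mk'_apply, AddMonoidHom.add_apply, ← map_add]
      congr 1
      simp only [Prod.fst_add, Prod.snd_add]
      ring

theorem tracePolar_apply (ω m : K) (z w : K × K) : tracePolar ω m z w = Algebra.trace ℚ K
    (ω * ((2 * z.1 + z.2) * w.1 + (z.1 - 2 * m * z.2) * w.2)) := rfl

theorem exists_sum_addChar_norm_form_pos {m : 𝓞 K} (hpos : ∀ σ : K →+* ℝ, 0 < σ (1 + 4 * m))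
    {u δ : K} (hδ0 : δ ≠ 0) (hδ : ∀ x : 𝓞 K, ∃ n : ℤ, Algebra.trace ℚ K (δ * x) = n)
    (hu : ∀ y : K, (∀ x : 𝓞 K, ∃ n : ℤ, Algebra.trace ℚ K (y * x) = n) →
      ∃ z : 𝓞 K, (z : K) = u * y)
    {h : 𝓞 K} (hh : (h : K) = (1 + 4 * m) * (u * δ)) (hh0 : h ≠ 0) {β : 𝓞 K} (hβ : β ≠ 0)
    (ψ : AddChar (𝓞 K ⧸ Ideal.span {h ^ 2 * β}) ℂ)
    (hψ : ∀ x : 𝓞 K, ψ (Ideal.Quotient.mk _ x) =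
      ratExp (Algebra.trace ℚ K (δ * x / (h ^ 2 * β : 𝓞 K))))
    [Fintype (𝓞 K ⧸ Ideal.span {h ^ 2 * β})] :
    ∃ r : ℝ, 0 < r ∧ ∑ z : (𝓞 K ⧸ Ideal.span {h ^ 2 * β}) × (𝓞 K ⧸ Ideal.span {h ^ 2 * β}),
      ψ (z.1 ^ 2 + z.1 * z.2 - Ideal.Quotient.mk _ m * z.2 ^ 2) = r := by
  have hhK : (h : K) ≠ 0 := by simpa using hh0
  have hβK : (β : K) ≠ 0 := by simpa using hβ
  have htwo : ((2 : 𝓞 K) : K) = 2 := map_ofNat (algebraMap (𝓞 K) K) 2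
  have ha : (1 + 4 * m : K) ≠ 0 := by
    intro h0
    rw [h0, zero_mul] at hh
    exact hhK hh
  set ω : K := δ / (h ^ 2 * β) with hω
  have hω0 : ω ≠ 0 := by positivity
  obtain ⟨v, c, hc, hsig, hdiag⟩ := exists_diagonal_norm_form hω0 ha hpos
  let E : (K × K) ≃ₗ[ℚ] (K × K) :=
    { toFun := fun z ↦ (z.1 + z.2 / 2, z.2 / 2)
      invFun := fun z ↦ (z.1 - z.2, 2 * z.2)
      left_inv := fun z ↦ Prod.ext (by simp) (by simp; ring)
      right_inv := fun z ↦ Prod.ext (by simp) (by simp)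
      map_add' := fun z w ↦ Prod.ext (by simp; ring) (by simp; ring)
      map_smul' := fun r z ↦ Prod.ext (by simp [Algebra.smul_def]; ring)
        (by simp [Algebra.smul_def]; ring) }
  have hEdiag : ∀ z : K × K, Algebra.trace ℚ K (ω * (z.1 ^ 2 + z.1 * z.2 - m * z.2 ^ 2)) =
      ∑ i, c i * (v.map E.symm).repr z i ^ 2 := by
    intro z
    have := hdiag (E z)
    simp only [Module.Basis.map_repr, LinearEquiv.trans_apply, LinearEquiv.symm_symm]
    rw [← this]
    congr 2
    change _ = (z.1 + z.2 / 2) ^ 2 - (1 + 4 * m) * (z.2 / 2) ^ 2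
    ring
  have hinteg : ∀ x : K, ∃ k : ℕ, 0 < k ∧ ∃ z : 𝓞 K, k * x = h * β * z := by
    intro x
    have halg : Algebra.IsAlgebraic ℤ K :=
      (IsFractionRing.comap_isAlgebraic_iff (A := ℤ) (K := ℚ)).mpr inferInstance
    obtain ⟨d, hd, hz⟩ := (halg.isAlgebraic (x / (h * β))).exists_integral_multiple
    obtain ⟨z, hz⟩ : ∃ z : 𝓞 K, (z : K) = d • (x / (h * β)) := ⟨⟨_, hz⟩, rfl⟩
    refine ⟨d.natAbs, Int.natAbs_pos.mpr hd, d.sign * z, ?_⟩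
    have h1 : ((d.natAbs : ℤ) : K) = (d.sign : ℤ) * d := by
      rw [← Int.cast_mul, Int.sign_mul_self_eq_natAbs]
    have h2 : ((d.sign * z : 𝓞 K) : K) = d.sign * z := by
      push_cast
      rfl
    rw [← Int.cast_natCast, h1, h2, hz, zsmul_eq_mul]
    field_simp
  have hΛ : ∀ i, ∃ k : ℕ, 0 < k ∧ k • v.map E.symm i ∈ integerLattice (h * β : K) := by
    intro i
    obtain ⟨k, hk, x, hx⟩ := hinteg (v.map E.symm i).1
    obtain ⟨l, hl, y, hy⟩ := hinteg (v.map E.symm i).2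
    refine ⟨k * l, by positivity, l * x, k * y, Prod.ext ?_ ?_⟩
    · rw [Prod.smul_fst, nsmul_eq_mul]
      push_cast
      linear_combination l * hx
    · rw [Prod.smul_snd, nsmul_eq_mul]
      push_cast
      linear_combination k * hy
  have h0 : ∀ x ∈ integerLattice (h * β : K), ∃ n : ℤ,
      Algebra.trace ℚ K (ω * (x.1 ^ 2 + x.1 * x.2 - m * x.2 ^ 2)) = n := by
    rintro _ ⟨x, y, rfl⟩
    obtain ⟨n, hn⟩ := hδ (β * (x ^ 2 + x * y - m * y ^ 2))
    refine ⟨n, hn ▸ congrArg _ ?_⟩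
    push_cast
    rw [hω]
    field_simp
  have h1 : dualLattice (tracePolar ω m) (integerLattice (h * β : K)) ≤ integerLattice 1 := by
    intro z hz
    rw [mem_dualLattice] at hz
    have h1 : ∃ t : 𝓞 K, (t : K) = u * (δ / h * (2 * z.1 + z.2)) := hu _ fun x ↦ by
      obtain ⟨n, hn⟩ := hz (h * β * x, h * β * (0 : 𝓞 K)) ⟨x, 0, rfl⟩
      refine ⟨n, hn ▸ ?_⟩
      rw [tracePolar_apply]
      congr 1
      simp only [map_zero, mul_zero, add_zero]
      rw [hω]
      field_simp
    have h2 : ∃ t : 𝓞 K, (t : K) = u * (δ / h * (z.1 - 2 * m * z.2)) := hu _ fun x ↦ by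
      obtain ⟨n, hn⟩ := hz (h * β * (0 : 𝓞 K), h * β * x) ⟨0, x, rfl⟩
      refine ⟨n, hn ▸ ?_⟩
      rw [tracePolar_apply]
      congr 1
      simp only [map_zero, mul_zero, zero_add]
      rw [hω]
      field_simp
    obtain ⟨t1, ht1⟩ := h1
    obtain ⟨t2, ht2⟩ := h2
    have hone : (1 + 4 * m) * (u * (δ / h)) = (1 : K) := by
      rw [← mul_div_assoc, ← mul_div_assoc, ← hh, div_self hhK]
    refine ⟨2 * m * t1 + t2, t1 - 2 * t2, Prod.ext ?_ ?_⟩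
    · push_cast [htwo]
      linear_combination (-z.1) * hone - 2 * m * ht1 - ht2
    · push_cast [htwo]
      linear_combination (-z.2) * hone - ht1 + 2 * ht2
  have h2 : integerLattice ((h ^ 2 * β : 𝓞 K) : K) ≤ integerLattice (h * β : K) := by
    rintro _ ⟨x, y, rfl⟩
    refine ⟨h * x, h * y, Prod.ext ?_ ?_⟩ <;> push_cast <;> ring
  have h12 : ∀ x ∈ integerLattice (1 : K), ∀ y ∈ integerLattice ((h ^ 2 * β : 𝓞 K) : K),
      ∃ n : ℤ, tracePolar ω m x y = n := by
    rintro _ ⟨x, y, rfl⟩ _ ⟨x', y', rfl⟩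
    obtain ⟨n, hn⟩ := hδ ((2 * x + y) * x' + (x - 2 * m * y) * y')
    refine ⟨n, hn ▸ ?_⟩
    rw [tracePolar_apply]
    congr 1
    push_cast [htwo]
    rw [hω]
    field_simp
  obtain ⟨r, hr, hr'⟩ := exists_gauss_sum_eq_pos (v.map E.symm) c hc hsig
    (fun z ↦ Algebra.trace ℚ K (ω * (z.1 ^ 2 + z.1 * z.2 - m * z.2 ^ 2))) (tracePolar ω m)
    (fun z w ↦ by
      rw [tracePolar_apply, ← map_add, ← map_add]
      congr 1
      simp only [Prod.fst_add, Prod.snd_add]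
      ring) hEdiag
    hΛ h0 h1 h2 h12
    (isCosetReps_integerLattice (h ^ 2 * β))
  refine ⟨r, hr, hr' ▸ Finset.sum_congr rfl fun z _ ↦ ?_⟩
  have hz1 : z.1 = Ideal.Quotient.mk _ (Quotient.out z.1) := (Quotient.out_eq _).symm
  have hz2 : z.2 = Ideal.Quotient.mk _ (Quotient.out z.2) := (Quotient.out_eq _).symm
  conv_lhs => rw [hz1, hz2, ← map_pow, ← map_pow, ← map_mul, ← map_mul, ← map_add, ← map_sub, hψ]
  congr 2
  push_cast
  rw [hω]
  ring

end TraceSums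

section Reciprocity

theorem bijective_mk_add_mul {R : Type*} [CommRing R] {g b c : R}
    (hco : IsCoprime g b) (hc : c = g * b) :
    Function.Bijective fun z : (R ⧸ Ideal.span {g}) × (R ⧸ Ideal.span {b}) ↦
      Ideal.Quotient.mk (Ideal.span {c}) (b * Quotient.out z.1 + g * Quotient.out z.2) := by
  subst hc
  have hmk : ∀ (c x y : R), Ideal.Quotient.mk (Ideal.span {c}) x = Ideal.Quotient.mk _ y ↔
      c ∣ x - y := fun c x y ↦ by
    rw [Ideal.Quotient.mk_eq_mk_iff_sub_mem, Ideal.mem_span_singleton]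
  constructor
  · rintro ⟨x, y⟩ ⟨x', y'⟩ h
    obtain ⟨k, hk⟩ := (hmk _ _ _).mp h
    refine Prod.ext ?_ ?_
    · rw [← Quotient.out_eq x, ← Quotient.out_eq x']
      refine (hmk g _ _).mpr (hco.dvd_of_dvd_mul_left ⟨b * k - (Quotient.out y - Quotient.out y'), ?_⟩)
      linear_combination hk
    · rw [← Quotient.out_eq y, ← Quotient.out_eq y']
      refine (hmk b _ _).mpr
        (hco.symm.dvd_of_dvd_mul_left ⟨g * k - (Quotient.out x - Quotient.out x'), ?_⟩)
      linear_combination hk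
  · intro w
    obtain ⟨w, rfl⟩ := Ideal.Quotient.mk_surjective w
    obtain ⟨p, q, hpq⟩ := hco
    refine ⟨(Ideal.Quotient.mk _ (q * w), Ideal.Quotient.mk _ (p * w)), (hmk _ _ _).mpr ?_⟩
    obtain ⟨k, hk⟩ := (hmk g _ _).mp (Quotient.out_eq (Ideal.Quotient.mk (Ideal.span {g}) (q * w)))
    obtain ⟨l, hl⟩ := (hmk b _ _).mp (Quotient.out_eq (Ideal.Quotient.mk (Ideal.span {b}) (p * w)))
    exact ⟨k + l, by linear_combination b * hk + g * hl + w * hpq⟩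

variable {K : Type*} [Field K] [NumberField K]

/-- Multiplicativity of the quadratic exponential sums of the norm form in coprime moduli. -/
theorem sum_addChar_norm_form_mul_of_isCoprime {δ : K}
    (hδ : ∀ x : 𝓞 K, ∃ n : ℤ, Algebra.trace ℚ K (δ * x) = n) {g b c m : 𝓞 K}
    (hg0 : g ≠ 0) (hb0 : b ≠ 0) (hco : IsCoprime g b) (hc : c = g * b)
    [Fintype (𝓞 K ⧸ Ideal.span {g})] [Fintype (𝓞 K ⧸ Ideal.span {b})]
    [Fintype (𝓞 K ⧸ Ideal.span {c})]
    {ψ₁ : AddChar (𝓞 K ⧸ Ideal.span {g}) ℂ} {ψ₂ : AddChar (𝓞 K ⧸ Ideal.span {b}) ℂ}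
    {ψ : AddChar (𝓞 K ⧸ Ideal.span {c}) ℂ}
    (hψ₁ : ∀ x : 𝓞 K, ψ₁ (Ideal.Quotient.mk _ x) = ratExp (Algebra.trace ℚ K (δ * x / g)))
    (hψ₂ : ∀ x : 𝓞 K, ψ₂ (Ideal.Quotient.mk _ x) = ratExp (Algebra.trace ℚ K (δ * x / b)))
    (hψ : ∀ x : 𝓞 K, ψ (Ideal.Quotient.mk _ x) = ratExp (Algebra.trace ℚ K (δ * x / c))) :
    (∑ z : (𝓞 K ⧸ Ideal.span {g}) × (𝓞 K ⧸ Ideal.span {g}), ψ₁ (Ideal.Quotient.mk _ b *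
      (z.1 ^ 2 + z.1 * z.2 - Ideal.Quotient.mk _ m * z.2 ^ 2))) *
    (∑ w : (𝓞 K ⧸ Ideal.span {b}) × (𝓞 K ⧸ Ideal.span {b}), ψ₂ (Ideal.Quotient.mk _ g *
      (w.1 ^ 2 + w.1 * w.2 - Ideal.Quotient.mk _ m * w.2 ^ 2))) =
    ∑ z : (𝓞 K ⧸ Ideal.span {c}) × (𝓞 K ⧸ Ideal.span {c}), ψ
      (z.1 ^ 2 + z.1 * z.2 - Ideal.Quotient.mk _ m * z.2 ^ 2) := by
  have hφ := bijective_mk_add_mul hco hc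
  have hgK : (g : K) ≠ 0 := by simpa using hg0
  have hbK : (b : K) ≠ 0 := by simpa using hb0
  have htwo : ((2 : 𝓞 K) : K) = 2 := map_ofNat (algebraMap (𝓞 K) K) 2
  rw [Finset.sum_mul_sum, ← Fintype.sum_prod_type']
  refine Fintype.sum_bijective (fun p ↦ Prod.map _ _ ((p.1.1, p.2.1), (p.1.2, p.2.2)))
    ((hφ.prodMap hφ).comp (Equiv.prodProdProdComm _ _ _ _).bijective) _ _ fun ⟨⟨x, x'⟩, y, y'⟩ ↦ ?_
  set X := Quotient.out x with hX
  set X' := Quotient.out x' with hX'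
  set Y := Quotient.out y with hY
  set Y' := Quotient.out y' with hY'
  have ex : x = Ideal.Quotient.mk _ X := (Quotient.out_eq x).symm
  have ex' : x' = Ideal.Quotient.mk _ X' := (Quotient.out_eq x').symm
  have ey : y = Ideal.Quotient.mk _ Y := (Quotient.out_eq y).symm
  have ey' : y' = Ideal.Quotient.mk _ Y' := (Quotient.out_eq y').symm
  have e₁ : Ideal.Quotient.mk (Ideal.span {g}) b * (x ^ 2 + x * x' - Ideal.Quotient.mk _ m * x' ^ 2) =
      Ideal.Quotient.mk _ (b * (X ^ 2 + X * X' - m * X' ^ 2)) := by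
    rw [ex, ex']; simp only [map_mul, map_add, map_sub, map_pow]
  have e₂ : Ideal.Quotient.mk (Ideal.span {b}) g * (y ^ 2 + y * y' - Ideal.Quotient.mk _ m * y' ^ 2) =
      Ideal.Quotient.mk _ (g * (Y ^ 2 + Y * Y' - m * Y' ^ 2)) := by
    rw [ey, ey']; simp only [map_mul, map_add, map_sub, map_pow]
  dsimp only [Prod.map]
  rw [e₁, e₂, ← hX, ← hX', ← hY, ← hY', ← map_pow, ← map_pow, ← map_mul, ← map_mul, ← map_add,
    ← map_sub, hψ₁, hψ₂, hψ, ← ratExp_add]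
  obtain ⟨n, hn⟩ := hδ (2 * X * Y + X * Y' + X' * Y - 2 * m * X' * Y')
  rw [← mul_one (ratExp (_ + _)), ← ratExp_intCast n, ← ratExp_add, ← hn, ← map_add, ← map_add]
  congr 2
  subst hc
  push_cast [htwo]
  field_simp
  ring

/-- If `a = 1 + 4 * m` is totally positive and `b` is a prime element congruent to `1` modulo
`2 * a`, then `a` is a square modulo `b`. -/
theorem isSquare_mk_of_prime_of_totally_pos {m b k : 𝓞 K}
    (hpos : ∀ σ : K →+* ℝ, 0 < σ (1 + 4 * m)) (hb : Prime b)
    (hbk : b - 1 = 2 * (1 + 4 * m) * k) :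
    IsSquare (Ideal.Quotient.mk (Ideal.span {b}) (1 + 4 * m)) := by
  by_contra hns
  have hfour : ((4 : 𝓞 K) : K) = 4 := map_ofNat (algebraMap (𝓞 K) K) 4
  have hone : ((1 : 𝓞 K) : K) = 1 := map_one (algebraMap (𝓞 K) K)
  obtain ⟨u, δ, t, ht, hbt, hδ, hu⟩ := exists_mul_inverse_different_not_dvd hb.not_isUnit
  have hb1 : ¬b ∣ 1 := fun h ↦ hb.not_isUnit (isUnit_of_dvd_one h)
  have hba : ¬b ∣ 1 + 4 * m := by
    rintro ⟨c, hc⟩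
    exact hb1 ⟨1 - 2 * c * k, by linear_combination -hbk - 2 * k * hc⟩
  have hb2 : ¬b ∣ 2 := by
    rintro ⟨c, hc⟩
    exact hb1 ⟨1 - (1 + 4 * m) * c * k, by linear_combination -hbk - (1 + 4 * m) * k * hc⟩
  set h : 𝓞 K := (1 + 4 * m) * t with hh
  have hbh : ¬b ∣ h := hb.not_dvd_mul hba hbt
  have hh0 : h ≠ 0 := fun h0 ↦ hbh (h0 ▸ dvd_zero b)
  have hhK : (h : K) = (1 + 4 * m) * (u * δ) := by
    rw [← ht, hh]
    push_cast [hfour]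
    rfl
  have hδ0 : δ ≠ 0 := by
    rintro rfl
    rw [mul_zero] at ht
    exact hbt ⟨0, RingOfIntegers.coe_injective (by simpa using ht)⟩
  have hb0 := hb.ne_zero
  have hbK : (b : K) ≠ 0 := by simpa using hb0
  have hhK0 : (h : K) ≠ 0 := by simpa using hh0
  have hmax : (Ideal.span {b}).IsMaximal :=
    ((Ideal.span_singleton_prime hb0).mpr hb).isMaximal (by simpa using hb0)
  have hco : IsCoprime (h ^ 2 * 1) b := by
    rw [mul_one]
    refine IsCoprime.pow_left ?_
    obtain ⟨y, i, hi, h1⟩ := hmax.exists_inv (x := h) (by rwa [Ideal.mem_span_singleton])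
    obtain ⟨j, rfl⟩ := Ideal.mem_span_singleton.mp hi
    exact ⟨y, j, by linear_combination h1⟩
  have hg0 : h ^ 2 * 1 ≠ 0 := by simpa using hh0
  have hgb0 : h ^ 2 * b ≠ 0 := mul_ne_zero (pow_ne_zero 2 hh0) hb0
  have : Finite (𝓞 K ⧸ Ideal.span {h ^ 2 * 1}) :=
    Ideal.finiteQuotientOfFreeOfNeBot _ (by simpa using hh0)
  have : Finite (𝓞 K ⧸ Ideal.span {b}) :=
    Ideal.finiteQuotientOfFreeOfNeBot _ (by simpa using hb0)
  have : Finite (𝓞 K ⧸ Ideal.span {h ^ 2 * b}) :=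
    Ideal.finiteQuotientOfFreeOfNeBot _ (by simpa using ⟨hh0, hb0⟩)
  have := Fintype.ofFinite (𝓞 K ⧸ Ideal.span {h ^ 2 * 1})
  have := Fintype.ofFinite (𝓞 K ⧸ Ideal.span {b})
  have := Fintype.ofFinite (𝓞 K ⧸ Ideal.span {h ^ 2 * b})
  obtain ⟨ψ₁, hψ₁⟩ := exists_addChar_trace hδ hg0
  obtain ⟨ψ₂, hψ₂⟩ := exists_addChar_trace hδ hgb0
  obtain ⟨ψ, hψ⟩ := exists_addChar_trace hδ hb0
  obtain ⟨r₁, hr₁, h₁⟩ := exists_sum_addChar_norm_form_pos hpos hδ0 hδ hu hhK hh0 one_ne_zero ψ₁ hψ₁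
  obtain ⟨r₂, hr₂, h₂⟩ := exists_sum_addChar_norm_form_pos hpos hδ0 hδ hu hhK hh0 hb0 ψ₂ hψ₂
  have hunit : IsUnit (Ideal.Quotient.mk (Ideal.span {h ^ 2 * 1}) b) := by
    obtain ⟨p, q, hpq⟩ := hco
    refine IsUnit.of_mul_eq_one (Ideal.Quotient.mk _ q) ?_
    rw [← map_mul, ← map_one (Ideal.Quotient.mk _), Ideal.Quotient.mk_eq_mk_iff_sub_mem,
      Ideal.mem_span_singleton]
    exact ⟨-p, by linear_combination hpq⟩
  obtain ⟨s, s', hs⟩ := exists_norm_form_eq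
    (m := Ideal.Quotient.mk (Ideal.span {h ^ 2 * 1}) m) (b := Ideal.Quotient.mk _ b)
    (k := Ideal.Quotient.mk _ k)
    (by simpa only [map_sub, map_mul, map_add, map_one, map_ofNat] using
      congrArg (Ideal.Quotient.mk (Ideal.span {h ^ 2 * 1})) hbk) hunit
  rw [← sum_norm_form_mul hs hunit] at h₁
  let ψ' : AddChar (𝓞 K ⧸ Ideal.span {b}) ℂ := AddChar.mulShift ψ (Ideal.Quotient.mk _ (h ^ 2))
  have hψ' : ψ' ≠ 1 := by
    intro htriv
    obtain ⟨z, hz⟩ := hu (δ * h ^ 2 / b) fun x ↦ by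
      have h3 : ψ' (Ideal.Quotient.mk _ x) = 1 := by rw [htriv, AddChar.one_apply]
      rw [AddChar.mulShift_apply, ← map_mul, hψ, ratExp_eq_one_iff] at h3
      obtain ⟨n, hn⟩ := h3
      refine ⟨n, hn ▸ congrArg _ ?_⟩
      push_cast
      ring
    have h4 : b * z = t * h ^ 2 := by
      have h5 : (b : K) * z = t * h ^ 2 := by
        rw [hz, ht]
        field_simp
      refine RingOfIntegers.coe_injective ?_
      rw [map_mul, map_mul, map_pow]
      exact h5
    exact (hb.not_dvd_mul hbt fun h5 ↦ hbh (hb.dvd_of_dvd_pow h5)) ⟨z, h4.symm⟩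
  let := Ideal.Quotient.field (Ideal.span {b})
  obtain ⟨r, hr, h₃⟩ := sum_norm_form_eq_neg_normSq (F := 𝓞 K ⧸ Ideal.span {b})
    (m := Ideal.Quotient.mk _ m) (ψ := ψ') (by
      rw [← map_ofNat (Ideal.Quotient.mk (Ideal.span {b})) 2, Ne, Ideal.Quotient.eq_zero_iff_mem,
        Ideal.mem_span_singleton]
      exact hb2)
    (by simpa only [map_mul, map_add, map_one, map_ofNat] using hns) hψ' (Equiv.refl _)
  have hprod : (r₂ : ℂ) = r₁ * (-r : ℝ) := by
    rw [← h₁, ← h₂, ← h₃, ← sum_addChar_norm_form_mul_of_isCoprime hδ hg0 hb0 hco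
      (by rw [mul_one]) hψ₁ hψ hψ₂]
    simp only [ψ', AddChar.mulShift_apply, mul_one, Equiv.refl_apply]
  have : r₂ = r₁ * (-r) := by exact_mod_cast hprod
  nlinarith [mul_nonneg hr₁.le hr]

end Reciprocity

section LocalSolvability

theorem exists_sq_add_eq {F : Type*} [NormedField F] [CompleteSpace F] [IsUltrametricDist F]
    {ν : F} (hν : ‖ν‖ < 1) : ∃ s : F, s ^ 2 + s = ν := by
  let f : ℕ → F := fun n ↦ (fun s ↦ ν - s ^ 2)^[n] 0
  have hf : ∀ n, f (n + 1) = ν - f n ^ 2 := fun n ↦ Function.iterate_succ_apply' _ n 0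
  have hle : ∀ n, ‖f n‖ ≤ ‖ν‖ := by
    intro n
    induction n with
    | zero => simp [f]
    | succ n ih =>
      rw [hf, sub_eq_add_neg]
      refine (IsUltrametricDist.norm_add_le_max _ _).trans (max_le le_rfl ?_)
      rw [norm_neg, norm_pow]
      nlinarith [norm_nonneg (f n)]
  have hdist : ∀ n, dist (f n) (f (n + 1)) ≤ 1 * ‖ν‖ ^ n := by
    intro n
    induction n with
    | zero =>
      rw [dist_comm, dist_eq_norm]
      simpa [f] using hν.le
    | succ n ih =>
      rw [dist_eq_norm] at ih ⊢
      have h : f (n + 1) - f (n + 1 + 1) = -((f n + f (n + 1)) * (f n - f (n + 1))) := by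
        rw [hf (n + 1)]
        nth_rewrite 1 [hf n]
        ring
      rw [h, norm_neg, norm_mul, pow_succ']
      have h1 : ‖f n + f (n + 1)‖ ≤ ‖ν‖ :=
        (IsUltrametricDist.norm_add_le_max _ _).trans (max_le (hle _) (hle _))
      calc _ ≤ ‖ν‖ * (1 * ‖ν‖ ^ n) := mul_le_mul h1 ih (norm_nonneg _) (norm_nonneg _)
        _ = _ := by ring
  obtain ⟨s, hs⟩ := cauchySeq_tendsto_of_complete (cauchySeq_of_le_geometric _ _ hν hdist)
  have h1 := (Filter.tendsto_add_atTop_iff_nat 1).mpr hs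
  simp only [hf] at h1
  have h2 := tendsto_nhds_unique h1 (hs.pow 2 |>.const_sub ν)
  exact ⟨s, by linear_combination h2⟩

theorem isSquare_one_add_four_mul {F : Type*} [NormedField F] [CompleteSpace F]
    [IsUltrametricDist F] {ν : F} (hν : ‖ν‖ < 1) : IsSquare (1 + 4 * ν) := by
  obtain ⟨s, hs⟩ := exists_sq_add_eq hν
  exact ⟨1 + 2 * s, by linear_combination -4 * hs⟩

theorem isSquare_of_norm_sub_one_lt {F : Type*} [NormedField F] [CompleteSpace F]
    [IsUltrametricDist F] (h2 : ‖(2 : F)‖ = 1) {t : F} (ht : ‖t - 1‖ < 1) : IsSquare t := by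
  have h20 : (2 : F) ≠ 0 := norm_ne_zero_iff.mp (by rw [h2]; exact one_ne_zero)
  have h4 : (4 : F) = 2 ^ 2 := by norm_num
  have h := isSquare_one_add_four_mul (ν := (t - 1) / 4)
    (by rwa [norm_div, h4, norm_pow, h2, one_pow, div_one])
  rwa [mul_div_cancel₀ _ (by rw [h4]; exact pow_ne_zero 2 h20), add_sub_cancel] at h

theorem exists_sq_sub_mul_sq_eq_of_isSquare {F : Type*} [Field F] (h2 : (2 : F) ≠ 0) {a : F}
    (ha0 : a ≠ 0) (ha : IsSquare a) (N : F) : ∃ y z : F, y ^ 2 - a * z ^ 2 = N := by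
  obtain ⟨r, rfl⟩ := ha
  have hr : r ≠ 0 := left_ne_zero_of_mul ha0
  refine ⟨(N + 1) / 2, (1 - N) / (2 * r), ?_⟩
  field_simp
  ring

variable {K : Type*} [Field K] [NumberField K] (v : HeightOneSpectrum (𝓞 K))

theorem norm_algebraMap_adicCompletion_eq_one_iff (x : 𝓞 K) :
    ‖algebraMap (𝓞 K) (v.adicCompletion K) x‖ = 1 ↔ x ∉ v.asIdeal :=
  FinitePlace.norm_eq_one_iff_notMem K v x

theorem norm_algebraMap_adicCompletion_lt_one_iff (x : 𝓞 K) :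
    ‖algebraMap (𝓞 K) (v.adicCompletion K) x‖ < 1 ↔ x ∈ v.asIdeal :=
  FinitePlace.norm_lt_one_iff_mem K v x

theorem isSquare_mul_of_sub_mem {x y : 𝓞 K} (h2 : (2 : 𝓞 K) ∉ v.asIdeal)
    (hx : x ∉ v.asIdeal) (hxy : y - x ∈ v.asIdeal) :
    ∃ r : v.adicCompletion K, algebraMap (𝓞 K) (v.adicCompletion K) y =
      r ^ 2 * algebraMap (𝓞 K) (v.adicCompletion K) x := by
  have hx1 := (norm_algebraMap_adicCompletion_eq_one_iff v x).mpr hx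
  have hx0 : algebraMap (𝓞 K) (v.adicCompletion K) x ≠ 0 :=
    norm_ne_zero_iff.mp (by rw [hx1]; exact one_ne_zero)
  have h21 := (norm_algebraMap_adicCompletion_eq_one_iff v 2).mpr h2
  rw [map_ofNat] at h21
  have hxy1 := (norm_algebraMap_adicCompletion_lt_one_iff v _).mpr hxy
  rw [map_sub] at hxy1
  obtain ⟨r, hr⟩ := isSquare_of_norm_sub_one_lt h21
    (t := algebraMap (𝓞 K) (v.adicCompletion K) y / algebraMap (𝓞 K) (v.adicCompletion K) x)
    (by rwa [div_sub_one hx0, norm_div, hx1, div_one])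
  exact ⟨r, by rw [pow_two, ← hr, div_mul_cancel₀ _ hx0]⟩

theorem exists_sq_sub_mul_sq_eq_mul_quartic {a b c d : 𝓞 K} (ha0 : a ≠ 0)
    (ha8 : (8 : 𝓞 K) ∣ a - 1) (hb : 2 * a ∣ b - 1)
    (hab : ∃ w : 𝓞 K, b ∣ a - w ^ 2) :
    ∃ x y z : v.adicCompletion K,
      y ^ 2 - algebraMap (𝓞 K) (v.adicCompletion K) a * z ^ 2 =
        algebraMap (𝓞 K) (v.adicCompletion K) b *
          (x ^ 4 + 2 * algebraMap (𝓞 K) (v.adicCompletion K) c * x ^ 2 +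
            algebraMap (𝓞 K) (v.adicCompletion K) d) := by
  have hv1 : (1 : 𝓞 K) ∉ v.asIdeal := (Ideal.ne_top_iff_one _).mp v.isPrime.ne_top
  have hinj : Function.Injective (algebraMap (𝓞 K) (v.adicCompletion K)) :=
    FaithfulSMul.algebraMap_injective _ _
  have h20 : (2 : v.adicCompletion K) ≠ 0 := by
    rw [← map_ofNat (algebraMap (𝓞 K) (v.adicCompletion K)) 2,
      ← map_zero (algebraMap (𝓞 K) (v.adicCompletion K))]
    exact hinj.ne two_ne_zero
  have hofsq : IsSquare (algebraMap (𝓞 K) (v.adicCompletion K) a) →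
      ∃ x y z : v.adicCompletion K,
        y ^ 2 - algebraMap (𝓞 K) (v.adicCompletion K) a * z ^ 2 =
          algebraMap (𝓞 K) (v.adicCompletion K) b *
            (x ^ 4 + 2 * algebraMap (𝓞 K) (v.adicCompletion K) c * x ^ 2 +
              algebraMap (𝓞 K) (v.adicCompletion K) d) := fun h ↦ ⟨0,
    exists_sq_sub_mul_sq_eq_of_isSquare h20 (by simpa using hinj.ne ha0) h _⟩
  obtain ⟨l, hl⟩ := hb
  by_cases h2 : (2 : 𝓞 K) ∈ v.asIdeal
  · obtain ⟨k, hk⟩ := ha8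
    apply hofsq
    have h := isSquare_one_add_four_mul ((norm_algebraMap_adicCompletion_lt_one_iff v (2 * k)).mpr
      (v.asIdeal.mul_mem_right k h2))
    rw [← map_ofNat (algebraMap (𝓞 K) (v.adicCompletion K)) 4, ← map_mul,
      ← map_one (algebraMap (𝓞 K) (v.adicCompletion K)), ← map_add] at h
    rwa [show a = 1 + 4 * (2 * k) by linear_combination hk]
  by_cases hbv : b ∈ v.asIdeal
  · apply hofsq
    obtain ⟨w, hw⟩ := hab
    have haw := v.asIdeal.mem_of_dvd hw hbv
    have hwv : w ^ 2 ∉ v.asIdeal := fun h ↦ hv1 <| by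
      have ha : a ∈ v.asIdeal := by simpa using v.asIdeal.add_mem haw h
      rw [show (1 : 𝓞 K) = b - a * (2 * l) by linear_combination -hl]
      exact v.asIdeal.sub_mem hbv (v.asIdeal.mul_mem_right _ ha)
    obtain ⟨r, hr⟩ := isSquare_mul_of_sub_mem v h2 hwv haw
    exact ⟨r * algebraMap (𝓞 K) (v.adicCompletion K) w, by rw [hr, map_pow]; ring⟩
  obtain ⟨π, hπ, hπ0⟩ := Submodule.exists_mem_ne_zero_of_ne_bot v.ne_bot
  have hπK : algebraMap (𝓞 K) (v.adicCompletion K) π ≠ 0 := by simpa using hinj.ne hπ0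
  obtain ⟨q, hq⟩ := isSquare_mul_of_sub_mem v (y := 1 + 2 * c * π ^ 2 + d * π ^ 4) h2 hv1 <| by
    rw [show 1 + 2 * c * π ^ 2 + d * π ^ 4 - 1 = π * (2 * c * π + d * π ^ 3) by ring]
    exact v.asIdeal.mul_mem_right _ hπ
  suffices h : ∃ y z : v.adicCompletion K,
      y ^ 2 - algebraMap (𝓞 K) (v.adicCompletion K) a * z ^ 2 =
        algebraMap (𝓞 K) (v.adicCompletion K) b by
    obtain ⟨y, z, hyz⟩ := h
    simp only [map_add, map_mul, map_pow, map_one, map_ofNat, mul_one] at hq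
    refine ⟨1 / algebraMap (𝓞 K) (v.adicCompletion K) π,
      y * q / algebraMap (𝓞 K) (v.adicCompletion K) π ^ 2,
      z * q / algebraMap (𝓞 K) (v.adicCompletion K) π ^ 2, ?_⟩
    rw [← hyz]
    field_simp
    linear_combination (-(y ^ 2 - algebraMap (𝓞 K) (v.adicCompletion K) a * z ^ 2)) * hq
  by_cases hav : a ∈ v.asIdeal
  · obtain ⟨r, hr⟩ := isSquare_mul_of_sub_mem v (y := b) h2 hv1 <| by
      rw [hl, show 2 * a * l = a * (2 * l) by ring]
      exact v.asIdeal.mul_mem_right _ hav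
    exact ⟨r, 0, by rw [hr, map_one]; ring⟩
  · have := v.isMaximal
    have : Finite (𝓞 K ⧸ v.asIdeal) := Ideal.finiteQuotientOfFreeOfNeBot _ v.ne_bot
    let := Ideal.Quotient.field v.asIdeal
    obtain ⟨y, z, hyz⟩ := exists_sq_sub_mul_sq_eq (F := 𝓞 K ⧸ v.asIdeal)
      (a := Ideal.Quotient.mk _ a) (by
        rw [← map_ofNat (Ideal.Quotient.mk v.asIdeal) 2, Ne, Ideal.Quotient.eq_zero_iff_mem]
        exact h2) (by rwa [Ne, Ideal.Quotient.eq_zero_iff_mem]) (Ideal.Quotient.mk _ b)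
    obtain ⟨y, rfl⟩ := Ideal.Quotient.mk_surjective y
    obtain ⟨z, rfl⟩ := Ideal.Quotient.mk_surjective z
    have hbt : b - (y ^ 2 - a * z ^ 2) ∈ v.asIdeal := by
      rw [← Ideal.Quotient.mk_eq_mk_iff_sub_mem, ← hyz]
      simp only [map_sub, map_mul, map_pow]
    obtain ⟨r, hr⟩ := isSquare_mul_of_sub_mem v h2
      (fun h ↦ hbv (by simpa using v.asIdeal.add_mem hbt h)) hbt
    refine ⟨r * algebraMap (𝓞 K) (v.adicCompletion K) y,
      r * algebraMap (𝓞 K) (v.adicCompletion K) z, ?_⟩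
    rw [hr, map_sub, map_mul, map_pow, map_pow]
    ring

end LocalSolvability

/-- Proposition 3.2 (local solvability): with `a, b, c, e` chosen as in §3 and `d = c·e`, the
affine Châtelet surface `y² - a z² = b (x⁴ + 2c x² + d)` has points in every non-archimedean
completion of `K` and in `ℝ` under every real embedding. -/
theorem stmt_9 (K : Type*) [Field K] [NumberField K]
    (a b c e : 𝓞 K)
    (hap : (Ideal.span {a} : Ideal (𝓞 K)).IsPrime) (ha0 : Ideal.span {a} ≠ (⊥ : Ideal (𝓞 K)))
    (hbp : (Ideal.span {b} : Ideal (𝓞 K)).IsPrime) (hb0 : Ideal.span {b} ≠ (⊥ : Ideal (𝓞 K)))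
    (hcp : (Ideal.span {c} : Ideal (𝓞 K)).IsPrime) (hc0 : Ideal.span {c} ≠ (⊥ : Ideal (𝓞 K)))
    (hep : (Ideal.span {e} : Ideal (𝓞 K)).IsPrime) (he0 : Ideal.span {e} ≠ (⊥ : Ideal (𝓞 K)))
    (hdist : ([Ideal.span {a}, Ideal.span {b}, Ideal.span {c}, Ideal.span {e}] :
      List (Ideal (𝓞 K))).Pairwise (· ≠ ·))
    (ha8 : (8 : 𝓞 K) ∣ a - 1) (hapos : ∀ σ : K →+* ℝ, 0 < σ (algebraMap (𝓞 K) K a))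
    (hb : (2 * a) ∣ b - 1)
    (hc2 : (2 : 𝓞 K) ∣ c - 1) (hc : ¬ ∃ u : 𝓞 K, c - u ^ 2 ∈ (Ideal.span {a} : Ideal (𝓞 K)))
    (he : ¬ ∃ u : 𝓞 K, e - u ^ 2 ∈ (Ideal.span {a} : Ideal (𝓞 K))) :
    (∀ v : HeightOneSpectrum (𝓞 K),
      ∃ x y z : v.adicCompletion K,
        y ^ 2 - algebraMap (𝓞 K) (v.adicCompletion K) a * z ^ 2 =
          algebraMap (𝓞 K) (v.adicCompletion K) b *
            (x ^ 4 + 2 * algebraMap (𝓞 K) (v.adicCompletion K) c * x ^ 2 +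
              algebraMap (𝓞 K) (v.adicCompletion K) (c * e))) ∧
    (∀ σ : K →+* ℝ,
      ∃ x y z : ℝ,
        y ^ 2 - σ (algebraMap (𝓞 K) K a) * z ^ 2 =
          σ (algebraMap (𝓞 K) K b) *
            (x ^ 4 + 2 * σ (algebraMap (𝓞 K) K c) * x ^ 2 +
              σ (algebraMap (𝓞 K) K (c * e)))) := by
  have ha0' : a ≠ 0 := by simpa using ha0
  have hb0' : b ≠ 0 := by simpa using hb0
  refine ⟨fun v ↦ exists_sq_sub_mul_sq_eq_mul_quartic v ha0' ha8 hb ?_, fun σ ↦ ?_⟩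
  · obtain ⟨n, hn⟩ := ha8
    obtain ⟨k, hk⟩ := hb
    have ham : a = 1 + 4 * (2 * n) := by linear_combination hn
    obtain ⟨w, hw⟩ := isSquare_mk_of_prime_of_totally_pos (m := 2 * n) (k := k)
      (fun σ ↦ by
        have h := hapos σ
        rw [ham, map_add, map_mul, map_one, map_ofNat] at h
        exact h)
      ((Ideal.span_singleton_prime hb0').mp hbp) (ham ▸ hk)
    obtain ⟨w, rfl⟩ := Ideal.Quotient.mk_surjective w
    rw [← ham, ← map_mul, Ideal.Quotient.mk_eq_mk_iff_sub_mem, Ideal.mem_span_singleton] at hw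
    exact ⟨w, by rwa [pow_two]⟩
  · exact ⟨0, exists_sq_sub_mul_sq_eq_of_isSquare two_ne_zero (hapos σ).ne'
      (Real.isSquare_iff.mpr (hapos σ).le) _⟩
end

section
/- Let E be the elliptic curve over ℚ given by the Weierstrass equation y² = x³ − 4x. Then the group E(ℚ) of rational points of E consists of exactly four elements: the point at infinity and the affine points (0,0), (2,0), (−2,0). In particular E(ℚ) is isomorphic to ℤ/2ℤ × ℤ/2ℤ. -/
/-- The elliptic curve `y² = x³ - 4x` over `ℚ`. -/
def W11 : WeierstrassCurve.Affine ℚ :=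
  { a₁ := 0, a₂ := 0, a₃ := 0, a₄ := -4, a₆ := 0 }

/-- The quartic `s² = t⁴ + 1` has no rational point with `t ≠ 0`. -/
theorem Rat.sq_ne_pow_four_add_one {s t : ℚ} (ht : t ≠ 0) : s ^ 2 ≠ t ^ 4 + 1 := by
  intro h
  have hd : (t.den : ℚ) ≠ 0 := by exact_mod_cast t.den_nz
  have hq : (s * t.den ^ 2) ^ 2 = ((t.num ^ 4 + (t.den : ℤ) ^ 4 : ℤ) : ℚ) := by
    have ht' : t * t.den = t.num := Rat.mul_den_eq_num t
    push_cast
    rw [← ht']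
    linear_combination (t.den : ℚ) ^ 4 * h
  have hsq : IsSquare ((t.num ^ 4 + (t.den : ℤ) ^ 4 : ℤ) : ℚ) := ⟨s * t.den ^ 2, by rw [← hq, sq]⟩
  obtain ⟨c, hc⟩ := Rat.isSquare_intCast_iff.mp hsq
  exact not_fermat_42 (Rat.num_ne_zero.mpr ht) (by exact_mod_cast t.den_nz) (hc.trans (sq c).symm)

theorem W11_equation_iff (x y : ℚ) : W11.Equation x y ↔
    (x = 0 ∧ y = 0) ∨ (x = 2 ∧ y = 0) ∨ (x = -2 ∧ y = 0) := by
  have hE : W11.Equation x y ↔ y ^ 2 = x ^ 3 - 4 * x := by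
    rw [WeierstrassCurve.Affine.equation_iff]
    simp [W11, sub_eq_add_neg]
  rw [hE]
  constructor
  · intro h
    by_cases hx : x = 0
    · subst hx
      left
      simpa using h
    by_cases hy : y = 0
    · subst hy
      have h' : x * ((x - 2) * (x + 2)) = 0 := by linear_combination -h
      rcases mul_eq_zero.mp ((mul_eq_zero.mp h').resolve_left hx) with h2 | h2
      · exact Or.inr (Or.inl ⟨by linarith, rfl⟩)
      · exact Or.inr (Or.inr ⟨by linarith, rfl⟩)
    · refine absurd ?_ (Rat.sq_ne_pow_four_add_one (s := x / 2 - (y / (2 * x)) ^ 2)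
        (t := y / (2 * x)) (by positivity))
      field_simp
      linear_combination (-4 * x ^ 3) * h
  · rintro (⟨rfl, rfl⟩ | ⟨rfl, rfl⟩ | ⟨rfl, rfl⟩) <;> norm_num

theorem W11_add_self (P : W11.Point) : P + P = 0 := by
  cases P with
  | zero => rfl
  | some x y h =>
    apply WeierstrassCurve.Affine.Point.add_self_of_Y_eq
    have hy : y = 0 := by
      rcases (W11_equation_iff x y).mp h.1 with h | h | h <;> exact h.2
    simp [WeierstrassCurve.Affine.negY, W11, hy]

theorem W11_nonsingular {x y : ℚ} (h : W11.Equation x y) : W11.Nonsingular x y := by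
  rw [WeierstrassCurve.Affine.nonsingular_iff]
  refine ⟨h, Or.inl ?_⟩
  rcases (W11_equation_iff x y).mp h with ⟨rfl, rfl⟩ | ⟨rfl, rfl⟩ | ⟨rfl, rfl⟩ <;> norm_num [W11]

theorem W11_card_point : Nat.card W11.Point = 4 := by
  have n0 : W11.Nonsingular 0 0 := W11_nonsingular ((W11_equation_iff _ _).mpr (by simp))
  have n1 : W11.Nonsingular 2 0 := W11_nonsingular ((W11_equation_iff _ _).mpr (by simp))
  have n2 : W11.Nonsingular (-2) 0 := W11_nonsingular ((W11_equation_iff _ _).mpr (by simp))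
  have huniv : (Set.univ : Set W11.Point) =
      (({.zero, .some 0 0 n0, .some 2 0 n1, .some (-2) 0 n2} : Finset W11.Point) :
        Set W11.Point) := by
    ext P
    cases P with
    | zero => simp
    | some x y h =>
      simpa using (W11_equation_iff x y).mp h.1
  rw [← Set.ncard_univ, huniv, Set.ncard_coe_finset]
  rw [Finset.card_insert_of_notMem, Finset.card_insert_of_notMem, Finset.card_insert_of_notMem,
    Finset.card_singleton] <;> norm_num
  exact ⟨nofun, nofun, nofun⟩

theorem W11_isAddKleinFour : IsAddKleinFour W11.Point where
  card_four := W11_card_point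
  exponent_two := by
    have hdvd : AddMonoid.exponent W11.Point ∣ 2 :=
      AddMonoid.exponent_dvd_iff_forall_nsmul_eq_zero.mpr fun P => by
        rw [two_nsmul, W11_add_self]
    refine ((Nat.dvd_prime Nat.prime_two).mp hdvd).resolve_left fun h1 => ?_
    have := AddMonoid.exp_eq_one_iff.mp h1
    have h4 := W11_card_point
    rw [Nat.card_unique] at h4
    omega

/-- `E(ℚ)` for `E : y² = x³ - 4x` consists of exactly the point at infinity and the affine
points `(0,0)`, `(2,0)`, `(-2,0)`; in particular `E(ℚ) ≅ ℤ/2ℤ × ℤ/2ℤ`. -/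
theorem stmt_11 :
    (∀ x y : ℚ, W11.Equation x y ↔
      (x = 0 ∧ y = 0) ∨ (x = 2 ∧ y = 0) ∨ (x = -2 ∧ y = 0)) ∧
      Nonempty (W11.Point ≃+ (ZMod 2 × ZMod 2)) := by
  have := W11_isAddKleinFour
  exact ⟨W11_equation_iff, IsAddKleinFour.nonempty_addEquiv⟩
end

section
/- Let L = ℚ(√5) be the quadratic field obtained by adjoining a square root of 5 to ℚ, and let E be the elliptic curve over L given by the Weierstrass equation y² = x³ − 4x. Then the group E(L) of L-rational points of E consists of exactly four elements: the point at infinity and the affine points (0,0), (2,0), (−2,0); that is, E(L) = E(ℚ). -/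
/-- The quadratic field `L = ℚ(√5)`. -/
noncomputable def L12 : IntermediateField ℚ ℝ :=
  IntermediateField.adjoin ℚ {Real.sqrt 5}

/-- The elliptic curve `y² = x³ - 4x` over `L = ℚ(√5)`. -/
noncomputable def W12 : WeierstrassCurve.Affine L12 :=
  { a₁ := 0, a₂ := 0, a₃ := 0, a₄ := -4, a₆ := 0 }

lemma Int.exists_sq_of_isCoprime_of_mul_eq_sq {a b c : ℤ} (h : IsCoprime a b)
    (heq : a * b = c ^ 2) :
    (∃ r, a = r ^ 2 ∨ a = -r ^ 2) ∧ ∃ t, b = t ^ 2 ∨ b = -t ^ 2 :=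
  ⟨Int.sq_of_gcd_eq_one (Int.isCoprime_iff_gcd_eq_one.mp h) heq,
    Int.sq_of_gcd_eq_one (Int.isCoprime_iff_gcd_eq_one.mp h.symm) (by rw [mul_comm, heq])⟩

lemma Int.exists_sq_of_isCoprime_of_mul_eq_sq_of_nonneg {a b c : ℤ} (h : IsCoprime a b)
    (heq : a * b = c ^ 2) (ha : 0 ≤ a) (hb : 0 ≤ b) :
    (∃ r, a = r ^ 2) ∧ ∃ t, b = t ^ 2 := by
  obtain ⟨⟨r, hr⟩, t, ht⟩ := Int.exists_sq_of_isCoprime_of_mul_eq_sq h heq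
  refine ⟨⟨r, hr.elim id fun h ↦ ?_⟩, t, ht.elim id fun h ↦ ?_⟩ <;>
    nlinarith [sq_nonneg r, sq_nonneg t]

lemma Int.prime_five : Prime (5 : ℤ) := Int.prime_iff_natAbs_prime.mpr (by norm_num)

lemma Int.five_dvd_of_dvd_pow_four_sub_four_mul {t s : ℤ} (h : 5 ∣ t ^ 4 - 4 * s ^ 4) :
    5 ∣ t ∧ 5 ∣ s := by
  rw [← Nat.cast_ofNat] at h ⊢
  simp only [← ZMod.intCast_zmod_eq_zero_iff_dvd] at h ⊢
  push_cast at h ⊢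
  generalize (t : ZMod 5) = t at *
  generalize (s : ZMod 5) = s at *
  revert t s; decide

lemma Int.five_dvd_of_dvd_two_mul_sq_sub_sq {t q : ℤ} (h : 5 ∣ 2 * t ^ 2 - q ^ 2) : 5 ∣ t := by
  rw [← Nat.cast_ofNat] at h ⊢
  simp only [← ZMod.intCast_zmod_eq_zero_iff_dvd] at h ⊢
  push_cast at h ⊢
  generalize (t : ZMod 5) = t at *
  generalize (q : ZMod 5) = q at *
  revert t q; decide

lemma Int.not_isCoprime_of_five_dvd {a b : ℤ} (ha : 5 ∣ a) (hb : 5 ∣ b) : ¬ IsCoprime a b :=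
  fun h ↦ by simpa [Int.isUnit_iff] using h.isUnit_of_dvd' ha hb

/-- If `x` is even, a coprime solution of `x⁴ + 25y⁴ = z²` with `5 ∤ x` cannot exist. -/
lemma not_pow_four_add_of_even {x y z : ℤ} (hxy : IsCoprime x y) (h5 : ¬ 5 ∣ x)
    (hx : x ≠ 0) (hz : 0 < z) (hx2 : 2 ∣ x) : x ^ 4 + 25 * y ^ 4 ≠ z ^ 2 := by
  intro h
  have hy2 : y % 2 = 1 := by
    by_contra hy
    have := hxy.isUnit_of_dvd' hx2 (by omega : (2 : ℤ) ∣ y)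
    simp [Int.isUnit_iff] at this
  have hx5 : IsCoprime (5 : ℤ) x := Int.prime_five.irreducible.coprime_iff_not_dvd.mpr h5
  have hcop : IsCoprime (5 * y ^ 2) (x ^ 2) :=
    (IsCoprime.mul_left hx5 hxy.symm.pow_left).pow_right
  have hy8 : y ^ 2 % 4 = 1 := by
    rcases Int.emod_two_eq_zero_or_one y with h | h
    · omega
    · obtain ⟨k, hk⟩ : ∃ k, y = 2 * k + 1 := ⟨y / 2, by omega⟩
      rw [hk]; ring_nf; omega
  obtain ⟨m, n, h1, h2, -, h4, h5', hm⟩ := PythagoreanTriple.coprime_classification'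
    (x := 5 * y ^ 2) (y := x ^ 2) (z := z) (by unfold PythagoreanTriple; linear_combination h)
    (Int.isCoprime_iff_gcd_eq_one.mp hcop) (by omega) hz
  have hmn : IsCoprime m n := Int.isCoprime_iff_gcd_eq_one.mpr h4
  have hn : n % 2 = 0 := by
    rcases h5' with ⟨ha, hb⟩ | ⟨-, hb⟩
    · obtain ⟨u, rfl⟩ : ∃ k, m = 2 * k := ⟨m / 2, by omega⟩
      obtain ⟨v, rfl⟩ : ∃ k, n = 2 * k + 1 := ⟨n / 2, by omega⟩
      ring_nf at h1
      ring_nf at hy8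
      omega
    · exact hb
  obtain ⟨k, rfl⟩ : ∃ k, n = 2 * k := ⟨n / 2, by omega⟩
  obtain ⟨V, rfl⟩ := hx2
  have hV : m * k = V ^ 2 := by linarith
  have hV0 : 0 < V ^ 2 := by have : V ≠ 0 := by rintro rfl; simp at hx
                             positivity
  have hmk : IsCoprime m k := hmn.of_mul_right_right
  have hm0 : 0 < m := lt_of_le_of_ne hm (by rintro rfl; simp at hV; omega)
  have hk0 : 0 ≤ k := by nlinarith
  obtain ⟨⟨t, ht⟩, s, hs⟩ := Int.exists_sq_of_isCoprime_of_mul_eq_sq_of_nonneg hmk hV hm hk0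
  obtain ⟨ht5, hs5⟩ := Int.five_dvd_of_dvd_pow_four_sub_four_mul (t := t) (s := s)
    ⟨y ^ 2, by rw [h1, ht, hs]; ring⟩
  refine Int.not_isCoprime_of_five_dvd ?_ ?_ hmk
  · rw [ht]; exact dvd_pow ht5 (by norm_num)
  · rw [hs]; exact dvd_pow hs5 (by norm_num)

lemma exists_smaller_of_sq_add_sq {α β t r : ℤ} (hαβ : IsCoprime α β) (ht : t ≠ 0)
    (hmul : α * β = 5 * t ^ 2) (hadd : α ^ 2 + β ^ 2 = r ^ 2) :
    ∃ e f : ℤ, e ≠ 0 ∧ f ≠ 0 ∧ e ^ 4 + 25 * f ^ 4 = r ^ 2 := by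
  have key : ∀ α β : ℤ, IsCoprime α β → α * β = 5 * t ^ 2 → α ^ 2 + β ^ 2 = r ^ 2 → 5 ∣ α →
      ∃ e f : ℤ, e ≠ 0 ∧ f ≠ 0 ∧ e ^ 4 + 25 * f ^ 4 = r ^ 2 := by
    rintro _ β hc hmul hadd ⟨α, rfl⟩
    have hmul' : α * β = t ^ 2 := by linarith
    obtain ⟨⟨f, hf⟩, e, he⟩ :=
      Int.exists_sq_of_isCoprime_of_mul_eq_sq hc.of_mul_left_right hmul'
    refine ⟨e, f, ?_, ?_, ?_⟩
    · rintro rfl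
      have : β = 0 := by simpa using he
      rw [this, mul_zero] at hmul'
      exact ht (pow_eq_zero_iff two_ne_zero |>.mp hmul'.symm)
    · rintro rfl
      have : α = 0 := by simpa using hf
      rw [this, zero_mul] at hmul'
      exact ht (pow_eq_zero_iff two_ne_zero |>.mp hmul'.symm)
    · rw [← hadd]
      rcases hf with rfl | rfl <;> rcases he with rfl | rfl <;> ring
  rcases Int.prime_five.dvd_or_dvd (Dvd.intro _ hmul.symm) with h | h
  · exact key α β hαβ hmul hadd h
  · exact key β α hαβ.symm (by rw [mul_comm, hmul]) (by rw [add_comm, hadd]) h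

lemma exists_smaller_of_pow_four_add_of_even {x y z : ℤ} (hxy : IsCoprime x y) (h5 : ¬ 5 ∣ x)
    (hx : x ≠ 0) (hy : y ≠ 0) (hz : 0 < z) (hy2 : 2 ∣ y) (h : x ^ 4 + 25 * y ^ 4 = z ^ 2) :
    ∃ e f r : ℤ, e ≠ 0 ∧ f ≠ 0 ∧ e ^ 4 + 25 * f ^ 4 = r ^ 2 ∧ r.natAbs < z.natAbs := by
  have hx2 : x % 2 = 1 := by
    by_contra hx'
    have := hxy.isUnit_of_dvd' (by omega : (2 : ℤ) ∣ x) hy2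
    simp [Int.isUnit_iff] at this
  have hx5 : IsCoprime x (5 : ℤ) :=
    (Int.prime_five.irreducible.coprime_iff_not_dvd.mpr h5).symm
  have hcop : IsCoprime (x ^ 2) (5 * y ^ 2) :=
    (IsCoprime.mul_right hx5 hxy.pow_right).pow_left
  have hx4 : x ^ 2 % 4 = 1 := by
    obtain ⟨k, hk⟩ : ∃ k, x = 2 * k + 1 := ⟨x / 2, by omega⟩
    rw [hk]; ring_nf; omega
  obtain ⟨m, n, h1, h2, hz', h4, h5', hm⟩ := PythagoreanTriple.coprime_classification'
    (x := x ^ 2) (y := 5 * y ^ 2) (z := z) (by unfold PythagoreanTriple; linear_combination h)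
    (Int.isCoprime_iff_gcd_eq_one.mp hcop) (by omega) hz
  have hmn : IsCoprime m n := Int.isCoprime_iff_gcd_eq_one.mpr h4
  have hn : n % 2 = 0 ∧ m % 2 = 1 := by
    rcases h5' with ⟨ha, hb⟩ | ⟨ha, hb⟩
    · obtain ⟨u, rfl⟩ : ∃ k, m = 2 * k := ⟨m / 2, by omega⟩
      obtain ⟨v, rfl⟩ : ∃ k, n = 2 * k + 1 := ⟨n / 2, by omega⟩
      rw [h1] at hx4
      ring_nf at hx4
      omega
    · exact ⟨hb, ha⟩
  obtain ⟨k, rfl⟩ : ∃ k, n = 2 * k := ⟨n / 2, by omega⟩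
  obtain ⟨V, rfl⟩ := hy2
  have hV : m * k = 5 * V ^ 2 := by linarith
  have hV0 : 0 < V ^ 2 := by
    have : V ≠ 0 := by rintro rfl; simp at hy
    positivity
  have hmk : IsCoprime m k := hmn.of_mul_right_right
  have hm0 : 0 < m := lt_of_le_of_ne hm (by rintro rfl; simp at hV; omega)
  have hk0 : 0 < k := by nlinarith
  have hx0 : 0 < x ^ 2 := by positivity
  have hlt : 0 ≤ m - 2 * k := by nlinarith
  -- both `m - n` and `m + n` are odd, hence coprime
  have hpq : IsCoprime (m - 2 * k) (m + 2 * k) := by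
    have h2 : IsCoprime (m - 2 * k) 2 := by
      refine ⟨1, -((m - 2 * k) / 2), by omega⟩
    have hm' : IsCoprime (m - 2 * k) (2 * k) := by
      obtain ⟨u, v, huv⟩ := hmn
      exact ⟨u, u + v, by linear_combination huv⟩
    obtain ⟨u, v, huv⟩ := h2.mul_right hm'
    exact ⟨u - v, v, by linear_combination huv⟩
  obtain ⟨⟨p, hp⟩, q, hq⟩ := Int.exists_sq_of_isCoprime_of_mul_eq_sq_of_nonneg hpq
    (c := x) (by rw [h1]; ring) hlt (by positivity)
  rcases Int.prime_five.dvd_or_dvd (Dvd.intro _ hV.symm) with hd | hd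
  · obtain ⟨j, rfl⟩ := hd
    obtain ⟨-, t, rfl⟩ := Int.exists_sq_of_isCoprime_of_mul_eq_sq_of_nonneg
      hmk.of_mul_left_right (c := V) (by linarith) (by linarith) hk0.le
    have ht := Int.five_dvd_of_dvd_two_mul_sq_sub_sq (t := t) (q := q)
      ⟨-j, by rw [← hq]; ring⟩
    exact absurd hmk (Int.not_isCoprime_of_five_dvd (by simp) (dvd_pow ht (by norm_num)))
  · obtain ⟨j, rfl⟩ := hd
    obtain ⟨⟨r, rfl⟩, t, rfl⟩ := Int.exists_sq_of_isCoprime_of_mul_eq_sq_of_nonneg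
      hmk.of_mul_right_right (c := V) (by linarith) hm (by linarith)
    have hodd : ∀ w v : ℤ, v % 2 = 1 → v = w ^ 2 → w % 2 = 1 := by
      rintro w v hv rfl
      rcases Int.emod_two_eq_zero_or_one w with hw | hw
      · simp [pow_two, Int.mul_emod, hw] at hv
      · exact hw
    have hp2 := hodd p _ (by omega) hp
    have hq2 := hodd q _ (by omega) hq
    obtain ⟨α, hα⟩ : ∃ α, q = p + 2 * α := ⟨(q - p) / 2, by omega⟩
    have hqβ : q = α + (p + α) := by rw [hα]; ring
    obtain ⟨e, f, he, hf, hef⟩ := exists_smaller_of_sq_add_sq (α := α) (β := p + α) (t := t)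
      (r := r) (by
        rw [hp, hq, hα] at hpq
        obtain ⟨u, v, huv⟩ := hpq
        refine ⟨(u + v) * α + (2 * v - 2 * u) * (p + α), (u + v) * (p + α), ?_⟩
        linear_combination huv)
      (by rintro rfl; simp at hk0)
      (by rw [hα] at hq; linarith)
      (by rw [hα] at hq; linarith)
    refine ⟨e, f, r, he, hf, hef, ?_⟩
    rw [← Int.ofNat_lt, Int.natCast_natAbs, Int.natCast_natAbs, abs_of_pos hz, hz']
    have h1r : 1 ≤ |r| := Int.one_le_abs (by rintro rfl; simp at hm0)
    rw [← sq_abs r]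
    have : |r| ≤ |r| ^ 2 := by nlinarith
    nlinarith

theorem pow_four_add_twentyfive_mul_pow_four_ne_sq {x y : ℤ} (hx : x ≠ 0) (hy : y ≠ 0) (z : ℤ) :
    x ^ 4 + 25 * y ^ 4 ≠ z ^ 2 := by
  induction hn : z.natAbs using Nat.strong_induction_on generalizing x y z with
  | _ n ih =>
  subst hn
  intro h
  have hz : z ≠ 0 := by
    rintro rfl
    have : 0 < x ^ 4 := by positivity
    nlinarith [sq_nonneg (y ^ 2)]
  by_cases hxy : IsCoprime x y
  · by_cases h5 : 5 ∣ x
    · obtain ⟨x, rfl⟩ := h5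
      have : (5 : ℤ) ∣ z := Int.Prime.dvd_pow' (k := 2) (p := 5) (by norm_num)
        ⟨5 * (25 * x ^ 4 + y ^ 4), by rw [← h]; push_cast; ring⟩
      obtain ⟨w, rfl⟩ := this
      exact ih w.natAbs (by omega) hy (right_ne_zero_of_mul hx) w rfl (by linarith)
    · have h' : x ^ 4 + 25 * y ^ 4 = |z| ^ 2 := by rw [sq_abs, h]
      have hz' : 0 < |z| := abs_pos.mpr hz
      by_cases hx2 : 2 ∣ x
      · exact not_pow_four_add_of_even hxy h5 hx hz' hx2 h'
      by_cases hy2 : 2 ∣ y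
      · obtain ⟨e, f, r, he, hf, hef, hr⟩ :=
          exists_smaller_of_pow_four_add_of_even hxy h5 hx hy hz' hy2 h'
        exact ih r.natAbs (by rwa [Int.natAbs_abs] at hr) he hf r rfl hef
      · obtain ⟨a, rfl⟩ : ∃ k, x = 2 * k + 1 := ⟨x / 2, by omega⟩
        obtain ⟨b, rfl⟩ : ∃ k, y = 2 * k + 1 := ⟨y / 2, by omega⟩
        rcases Int.emod_two_eq_zero_or_one z with h0 | h0
        · obtain ⟨c, rfl⟩ : ∃ k, z = 2 * k := ⟨z / 2, by omega⟩
          ring_nf at h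
          omega
        · obtain ⟨c, rfl⟩ : ∃ k, z = 2 * k + 1 := ⟨z / 2, by omega⟩
          ring_nf at h
          omega
  · rw [Int.isCoprime_iff_gcd_eq_one] at hxy
    obtain ⟨p, hp, hpx, hpy⟩ := Nat.Prime.not_coprime_iff_dvd.mp hxy
    rw [← Int.natCast_dvd] at hpx hpy
    obtain ⟨a, rfl⟩ := hpx
    obtain ⟨b, rfl⟩ := hpy
    have : ((p : ℤ) ^ 2) ∣ z := by
      rw [← Int.pow_dvd_pow_iff two_ne_zero, ← h]
      exact ⟨a ^ 4 + 25 * b ^ 4, by ring⟩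
    obtain ⟨w, rfl⟩ := this
    have hp0 : (p : ℤ) ≠ 0 := by exact_mod_cast hp.ne_zero
    have hw : w ≠ 0 := by rintro rfl; simp at hz
    refine ih w.natAbs ?_ (right_ne_zero_of_mul hx) (right_ne_zero_of_mul hy) w rfl ?_
    · rw [Int.natAbs_mul, Int.natAbs_pow, Int.natAbs_natCast]
      have := Int.natAbs_pos.mpr hw
      have := Nat.one_lt_pow two_ne_zero hp.one_lt
      nlinarith
    · apply mul_left_cancel₀ (pow_ne_zero 4 hp0)
      linear_combination h

lemma Rat.exists_intCast_eq_of_sq_eq_intCast {q : ℚ} {n : ℤ} (h : q ^ 2 = n) :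
    ∃ k : ℤ, q = k := by
  have h1 : q.den ^ 2 = 1 := by rw [← Rat.den_pow, h, Rat.den_intCast]
  exact ⟨q.num, ((Rat.den_eq_one_iff q).mp (by simpa using h1)).symm⟩

/-- On rational points of `5y² = x³ - 4x`, `y = 0`. -/
lemma eq_zero_of_five_mul_sq_eq {x y : ℚ} (h : 5 * y ^ 2 = x ^ 3 - 4 * x) : y = 0 := by
  by_contra hy
  have hx : x ≠ 0 := by rintro rfl; simp at h; exact hy h
  obtain ⟨s, hs⟩ : ∃ s, s = y / x := ⟨_, rfl⟩
  have hs0 : s.num ≠ 0 := by rw [hs, Rat.num_ne_zero]; positivity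
  have hd0 : (s.den : ℚ) ≠ 0 := by simp
  have hw : 25 * s ^ 4 + 16 = ((x ^ 2 + 4) / x) ^ 2 := by
    have : 5 * s ^ 2 = (x ^ 2 - 4) / x := by
      rw [hs]; field_simp; linear_combination h
    have h25 : 25 * s ^ 4 = ((x ^ 2 - 4) / x) ^ 2 := by rw [← this]; ring
    rw [h25]; field_simp; ring
  have hsd : (s.num : ℚ) = s * s.den := (Rat.mul_den_eq_num s).symm
  have key : ((x ^ 2 + 4) / x * s.den ^ 2) ^ 2 =
      (((2 * s.den) ^ 4 + 25 * s.num ^ 4 : ℤ) : ℚ) := by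
    push_cast
    rw [mul_pow, ← hw, hsd]; ring
  obtain ⟨k, hk⟩ := Rat.exists_intCast_eq_of_sq_eq_intCast key
  rw [hk] at key
  exact pow_four_add_twentyfive_mul_pow_four_ne_sq (x := 2 * s.den) (by simp) hs0 k
    (by exact_mod_cast key.symm)

/-- On rational points of `y² = x³ - 4x`, `y = 0`. -/
lemma eq_zero_of_sq_eq {x y : ℚ} (h : y ^ 2 = x ^ 3 - 4 * x) : y = 0 := by
  by_contra hy
  have hx : x ≠ 0 := by rintro rfl; simp at h; exact hy h
  obtain ⟨s, hs⟩ : ∃ s, s = y / x := ⟨_, rfl⟩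
  have hs0 : s.num ≠ 0 := by rw [hs, Rat.num_ne_zero]; positivity
  have hw : s ^ 4 + 16 = ((x ^ 2 + 4) / x) ^ 2 := by
    have : s ^ 2 = (x ^ 2 - 4) / x := by
      rw [hs]; field_simp; linear_combination h
    have h25 : s ^ 4 = ((x ^ 2 - 4) / x) ^ 2 := by rw [← this]; ring
    rw [h25]; field_simp; ring
  have hsd : (s.num : ℚ) = s * s.den := (Rat.mul_den_eq_num s).symm
  have key : ((x ^ 2 + 4) / x * s.den ^ 2) ^ 2 =
      (((2 * s.den) ^ 4 + s.num ^ 4 : ℤ) : ℚ) := by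
    push_cast
    rw [mul_pow, ← hw, hsd]; ring
  obtain ⟨k, hk⟩ := Rat.exists_intCast_eq_of_sq_eq_intCast key
  rw [hk] at key
  exact not_fermat_42 (a := 2 * s.den) (b := s.num) (c := k) (by simp) hs0
    (by exact_mod_cast key.symm)

lemma eq_zero_or_eq_two_or_eq_neg_two {K : Type*} [Field K] {x : K} (h : x ^ 3 - 4 * x = 0) :
    x = 0 ∨ x = 2 ∨ x = -2 := by
  have : x * ((x - 2) * (x + 2)) = 0 := by linear_combination h
  simpa [sub_eq_zero, add_eq_zero_iff_eq_neg] using this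

/-- A binary quartic form which is anisotropic modulo `5` never takes values in `5 ℚ²`. -/
lemma quartic_ne_five_mul_sq (A B : ℤ)
    (hAB : ∀ p q : ZMod 5, p ^ 4 + A * p ^ 2 * q ^ 2 + B * q ^ 4 = 0 → p = 0 ∧ q = 0)
    (m b : ℚ) : m ^ 4 + A * m ^ 2 + B ≠ 5 * b ^ 2 := by
  intro h
  have hmd : (m.num : ℚ) = m * m.den := (Rat.mul_den_eq_num m).symm
  obtain ⟨N, hN⟩ : ∃ N : ℤ, N = m.num ^ 4 + A * m.num ^ 2 * m.den ^ 2 + B * m.den ^ 4 := ⟨_, rfl⟩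
  have key : (5 * b * m.den ^ 2) ^ 2 = ((5 * N : ℤ) : ℚ) := by
    rw [hN]; push_cast; rw [hmd]
    linear_combination (-5 * (m.den : ℚ) ^ 4) * h
  obtain ⟨k, hk⟩ := Rat.exists_intCast_eq_of_sq_eq_intCast key
  rw [hk] at key
  have key : k ^ 2 = 5 * N := by exact_mod_cast key
  obtain ⟨l, rfl⟩ : (5 : ℤ) ∣ k :=
    Int.Prime.dvd_pow' (k := 2) (p := 5) (by norm_num) ⟨N, key⟩
  have hN5 : ((N : ℤ) : ZMod 5) = 0 :=
    (ZMod.intCast_zmod_eq_zero_iff_dvd N 5).mpr ⟨l ^ 2, by push_cast; linarith⟩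
  rw [hN] at hN5
  push_cast at hN5
  obtain ⟨h1, h2⟩ := hAB _ _ hN5
  have h1 := (ZMod.intCast_zmod_eq_zero_iff_dvd _ 5).mp h1
  have h2 := (ZMod.natCast_eq_zero_iff _ 5).mp h2
  have := Nat.dvd_gcd (Int.natCast_dvd.mp h1) h2
  rw [m.reduced] at this
  norm_num at this

lemma Real.add_mul_sqrt_five_eq_zero {a b : ℚ} (h : (a : ℝ) + b * √5 = 0) : a = 0 ∧ b = 0 := by
  have hirr : Irrational (√5) := by
    simpa using Nat.Prime.irrational_sqrt (p := 5) (by norm_num)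
  have hb : b = 0 := by
    by_contra hb
    refine (hirr.ratCast_mul hb).ne_rat (-a) ?_
    push_cast; linarith
  subst hb
  exact ⟨by simpa using h, rfl⟩

lemma exists_eq_add_mul_sqrt_five {x : ℝ} (hx : x ∈ L12) : ∃ a b : ℚ, x = a + b * √5 := by
  have h5 : √5 ^ 2 = (5 : ℝ) := Real.sq_sqrt (by norm_num)
  induction hx using IntermediateField.adjoin_induction with
  | mem x hx => exact ⟨0, 1, by simpa using hx⟩
  | algebraMap x => exact ⟨x, 0, by simp⟩
  | add x y _ _ hx hy =>
    obtain ⟨a, b, rfl⟩ := hx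
    obtain ⟨c, d, rfl⟩ := hy
    exact ⟨a + c, b + d, by push_cast; ring⟩
  | inv x _ hx =>
    obtain ⟨a, b, rfl⟩ := hx
    by_cases h0 : (a : ℝ) + b * √5 = 0
    · exact ⟨0, 0, by simp [h0]⟩
    · have h1 : (a : ℝ) - b * √5 ≠ 0 := by
        intro h1
        obtain ⟨rfl, hb⟩ := Real.add_mul_sqrt_five_eq_zero (a := a) (b := -b)
          (by push_cast; linarith)
        rw [neg_eq_zero] at hb
        simp [hb] at h0
      have h2 : (a : ℝ) ^ 2 - 5 * b ^ 2 ≠ 0 := by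
        have := mul_ne_zero h0 h1
        contrapose! this
        linear_combination this - b ^ 2 * h5
      refine ⟨a / (a ^ 2 - 5 * b ^ 2), -b / (a ^ 2 - 5 * b ^ 2), ?_⟩
      push_cast
      apply inv_eq_of_mul_eq_one_right
      linear_combination mul_inv_cancel₀ h2 - b ^ 2 * ((a : ℝ) ^ 2 - 5 * b ^ 2)⁻¹ * h5
  | mul x y _ _ hx hy =>
    obtain ⟨a, b, rfl⟩ := hx
    obtain ⟨c, d, rfl⟩ := hy
    exact ⟨a * c + 5 * b * d, a * d + b * c, by push_cast; linear_combination b * d * h5⟩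

/-- The equation `y² = x³ - 4x` for `x = a + b√5`, `y = c + d√5`, in terms of coordinates. -/
lemma eq_zero_of_coordinates {a b c d : ℚ}
    (h1 : c ^ 2 + 5 * d ^ 2 = a ^ 3 + 15 * a * b ^ 2 - 4 * a)
    (h2 : 2 * c * d = 3 * a ^ 2 * b + 5 * b ^ 3 - 4 * b) : c = 0 ∧ d = 0 := by
  by_cases hb : b = 0
  · subst hb
    have : c = 0 ∨ d = 0 := by simpa using h2
    rcases this with rfl | rfl
    · exact ⟨rfl, eq_zero_of_five_mul_sq_eq (x := a) (by linarith)⟩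
    · exact ⟨eq_zero_of_sq_eq (x := a) (by linarith), rfl⟩
  · exfalso
    -- the line through the point and its conjugate meets the curve in a third, rational, point
    obtain ⟨m, rfl⟩ : ∃ m, d = m * b := ⟨d / b, by field_simp⟩
    have h2 : 2 * c * m = 3 * a ^ 2 + 5 * b ^ 2 - 4 := by
      apply mul_right_cancel₀ hb; linear_combination h2
    obtain ⟨t, ht⟩ : ∃ t, t = m ^ 2 - 2 * a := ⟨_, rfl⟩
    have hcurve : (m * t + (c - m * a)) ^ 2 = t ^ 3 - 4 * t := by
      rw [ht]
      linear_combination h1 + (m ^ 2 - 3 * a) * h2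
    have hy := eq_zero_of_sq_eq hcurve
    rw [hy] at hcurve
    have hc : c = m * (a - t) := by linear_combination hy
    rw [hc] at h1 h2
    rcases eq_zero_or_eq_two_or_eq_neg_two (x := t) (by linarith) with rfl | rfl | rfl
    · refine quartic_ne_five_mul_sq 0 16 (by decide) m (2 * b) ?_
      push_cast
      linear_combination (6 * a - m ^ 2) * ht + 4 * h2
    · refine quartic_ne_five_mul_sq (-12) 4 (by decide) m (2 * b) ?_
      push_cast
      linear_combination (6 * a - m ^ 2 - 6) * ht + 4 * h2
    · refine quartic_ne_five_mul_sq 12 4 (by decide) m (2 * b) ?_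
      push_cast
      linear_combination (6 * a - m ^ 2 + 6) * ht + 4 * h2

lemma eq_zero_of_mem_L12 {x y : ℝ} (hx : x ∈ L12) (hy : y ∈ L12) (h : y ^ 2 = x ^ 3 - 4 * x) :
    y = 0 := by
  have h5 : √5 ^ 2 = (5 : ℝ) := Real.sq_sqrt (by norm_num)
  obtain ⟨a, b, rfl⟩ := exists_eq_add_mul_sqrt_five hx
  obtain ⟨c, d, rfl⟩ := exists_eq_add_mul_sqrt_five hy
  obtain ⟨h1, h2⟩ := Real.add_mul_sqrt_five_eq_zero
    (a := c ^ 2 + 5 * d ^ 2 - (a ^ 3 + 15 * a * b ^ 2 - 4 * a))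
    (b := 2 * c * d - (3 * a ^ 2 * b + 5 * b ^ 3 - 4 * b)) (by
      push_cast
      linear_combination h + (3 * a * b ^ 2 - d ^ 2 + b ^ 3 * √5) * h5)
  obtain ⟨rfl, rfl⟩ := eq_zero_of_coordinates (sub_eq_zero.mp h1) (sub_eq_zero.mp h2)
  simp

lemma W12_equation_iff (x y : L12) : W12.Equation x y ↔
    (x = 0 ∧ y = 0) ∨ (x = 2 ∧ y = 0) ∨ (x = -2 ∧ y = 0) := by
  have heq : W12.Equation x y ↔ y ^ 2 = x ^ 3 - 4 * x := by
    rw [WeierstrassCurve.Affine.equation_iff]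
    simp [W12, sub_eq_add_neg]
  rw [heq]
  constructor
  · intro h
    have hy : y = 0 := Subtype.ext <|
      eq_zero_of_mem_L12 x.2 y.2 (by exact congrArg Subtype.val h)
    subst hy
    simpa using eq_zero_or_eq_two_or_eq_neg_two (x := x) (by rw [← h]; ring)
  · rintro (⟨rfl, rfl⟩ | ⟨rfl, rfl⟩ | ⟨rfl, rfl⟩) <;> ring

lemma W12_nonsingular_iff (x y : L12) : W12.Nonsingular x y ↔
    (x = 0 ∧ y = 0) ∨ (x = 2 ∧ y = 0) ∨ (x = -2 ∧ y = 0) := by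
  rw [← W12_equation_iff, WeierstrassCurve.Affine.equation_iff_nonsingular_of_Δ_ne_zero]
  simp only [WeierstrassCurve.Δ, WeierstrassCurve.b₂, WeierstrassCurve.b₄, WeierstrassCurve.b₆,
    WeierstrassCurve.b₈, W12]
  norm_num

open WeierstrassCurve.Affine in
lemma nonempty_W12_point_equiv : Nonempty (W12.Point ≃ Fin 4) := by
  have h0 : W12.Nonsingular 0 0 := (W12_nonsingular_iff _ _).mpr (by simp)
  have h2 : W12.Nonsingular 2 0 := (W12_nonsingular_iff _ _).mpr (by simp)
  have hm2 : W12.Nonsingular (-2) 0 := (W12_nonsingular_iff _ _).mpr (by simp)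
  let f : Fin 4 → W12.Point := ![.zero, .some 0 0 h0, .some 2 0 h2, .some (-2) 0 hm2]
  have hne : (2 : L12) ≠ -2 := by
    intro h
    have : (4 : L12) = 0 := by linear_combination h
    norm_num at this
  refine ⟨(Equiv.ofBijective f ⟨?_, ?_⟩).symm⟩
  · intro i j hij
    fin_cases i <;> fin_cases j <;> simp [f, hne, hne.symm] at hij ⊢
  · rintro (_ | ⟨x, y, h⟩)
    · exact ⟨0, rfl⟩
    · rcases (W12_nonsingular_iff x y).mp h with ⟨rfl, rfl⟩ | ⟨rfl, rfl⟩ | ⟨rfl, rfl⟩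
      exacts [⟨1, rfl⟩, ⟨2, rfl⟩, ⟨3, rfl⟩]

/-- `E(L)` for `E : y² = x³ - 4x` and `L = ℚ(√5)` consists of exactly the point at infinity
and the affine points `(0,0)`, `(2,0)`, `(-2,0)`; that is, `E(L) = E(ℚ)` has four elements. -/
theorem stmt_12 :
    (∀ x y : L12, W12.Equation x y ↔
      (x = 0 ∧ y = 0) ∨ (x = 2 ∧ y = 0) ∨ (x = -2 ∧ y = 0)) ∧
      Nonempty (W12.Point ≃ Fin 4) :=
  ⟨W12_equation_iff, nonempty_W12_point_equiv⟩
end
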